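/- arXiv:2006.07955 — 3 statements merged into one kernel-verified Lean document; each statement's English description precedes it below -/
import Mathlib

section
/- Let q and p be probability mass functions on countable sets such that q is majorized by p (q ⪯ p). Then p is an aggregation of the product pmf q × Geom_{1/2} (i.e., q × Geom_{1/2} ⊑ p): there exists a function g from the support of q × Geom_{1/2} to the support of p such that p is the pushforward of q × Geom_{1/2} under g. -/
open scoped ENNReal Classical
open Filter

namespace MEC

/-- A probability mass function on `α`: (nonnegative) masses summing to `1`. -/
def IsPMF {α : Type*} (p : α → ℝ≥0∞) : Prop := ∑' x, p x = 1

/-- `p` is an aggregation of `q`, written `q ⊑ p`: there is a map `g` sending the support of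
`q` into the support of `p` such that `p` is the pushforward of `q` under `g`. -/
def Agg {α β : Type*} (q : α → ℝ≥0∞) (p : β → ℝ≥0∞) : Prop :=
  ∃ g : α → β, (∀ x, q x ≠ 0 → p (g x) ≠ 0) ∧
    ∀ y, p y = ∑' x, if g x = y then q x else 0

/-- Sum of the `k` largest masses of `p`, i.e. `max_{A, |A| ≤ k} p(A)`. -/
noncomputable def topk {α : Type*} (p : α → ℝ≥0∞) (k : ℕ) : ℝ≥0∞ :=
  ⨆ (A : Finset α) (_ : A.card ≤ k), ∑ x ∈ A, p x

/-- `q` is majorized by `p`, written `q ⪯ p`: for every `k`, the sum of the `k` largest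
masses of `q` is at most the sum of the `k` largest masses of `p`. -/
def Majorized {α β : Type*} (q : α → ℝ≥0∞) (p : β → ℝ≥0∞) : Prop :=
  ∀ k : ℕ, topk q k ≤ topk p k

/-- Product pmf `(q × r)(x,z) = q(x) · r(z)`. -/
noncomputable def prodFun {α β : Type*} (q : α → ℝ≥0∞) (r : β → ℝ≥0∞) : α × β → ℝ≥0∞ :=
  fun z => q z.1 * r z.2

/-- `Geom_{1/2}` on `ℕ+ = {1,2,3,...}`, with mass `2^{-x}` at `x`. -/
noncomputable def geomHalf : ℕ+ → ℝ≥0∞ := fun x => 2⁻¹ ^ (x : ℕ)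

/-- Capped geometric distribution `CGeom_{1/2,k}` on `{1,...,k} ⊆ ℕ+`. -/
noncomputable def cgeomHalf (k : ℕ) : ℕ+ → ℝ≥0∞ := fun x =>
  if (x : ℕ) < k then 2⁻¹ ^ (x : ℕ) else if (x : ℕ) = k then 2⁻¹ ^ (k - 1) else 0

/-- `inf_{p ∈ S} max_{A ⊆ supp(p), |A| ≤ k} p(A)`. -/
noncomputable def infTopk {α : Type*} (S : Set (α → ℝ≥0∞)) (k : ℕ) : ℝ≥0∞ :=
  ⨅ p ∈ S, topk p k

/-- The greatest lower bound `⋀S` of `S` with respect to majorization, as a pmf on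
`ℕ+ = {1,2,...}`, with `(⋀S)(k) = inf_{p∈S} max_{|A|≤k} p(A) − inf_{p∈S} max_{|A|≤k−1} p(A)`. -/
noncomputable def glb {α : Type*} (S : Set (α → ℝ≥0∞)) : ℕ+ → ℝ≥0∞ :=
  fun k => infTopk S (k : ℕ) - infTopk S ((k : ℕ) - 1)

/-- Condition for the existence of `⋀S`:
`lim_{k→∞} inf_{p∈S} max_{A⊆supp(p), |A|≤k} p(A) = 1`. -/
def GlbExists {α : Type*} (S : Set (α → ℝ≥0∞)) : Prop :=
  Tendsto (fun k => infTopk S k) atTop (nhds 1)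

/-- Base-2 logarithm on `ℝ≥0∞` (intended for arguments in `[1,∞]`). -/
noncomputable def log2 (x : ℝ≥0∞) : ℝ≥0∞ :=
  if x = ∞ then ∞ else ENNReal.ofReal (Real.logb 2 x.toReal)

/-- Shannon entropy (base 2): `H(p) = Σ_x p(x) log₂ (1/p(x))`. -/
noncomputable def shannon {α : Type*} (p : α → ℝ≥0∞) : ℝ≥0∞ :=
  ∑' x, p x * log2 (p x)⁻¹

/-- Rényi entropy of order `a ∈ [0,∞]` (base 2):
`H_a(p) = (1/(1−a)) log₂ Σ_{x ∈ supp(p)} p(x)^a` for `a ∉ {1,∞}` (for `a > 1` this is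
written in the equivalent form `(1/(a−1)) log₂ (Σ_{x ∈ supp(p)} p(x)^a)⁻¹` so that it is
nonnegative), Shannon entropy for `a = 1`, and `−log₂ max_x p(x)` for `a = ∞`. -/
noncomputable def renyi {α : Type*} (p : α → ℝ≥0∞) (a : ℝ≥0∞) : ℝ≥0∞ :=
  if a = 1 then shannon p
  else if a = ∞ then log2 (⨆ x, p x)⁻¹
  else if a < 1 then log2 (∑' x, if p x = 0 then 0 else p x ^ a.toReal) * (1 - a)⁻¹
  else log2 (∑' x, if p x = 0 then 0 else p x ^ a.toReal)⁻¹ * (a - 1)⁻¹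

/-- `q ∈ Γ̃(S)`: `q` (a pmf over `ℕ`, without loss of generality) is an underlying
distribution of a coupling of `S`, i.e. `q ⊑ p` for every `p ∈ S`. -/
def UnderlyingCoupling {α : Type*} (S : Set (α → ℝ≥0∞)) (q : ℕ → ℝ≥0∞) : Prop :=
  IsPMF q ∧ ∀ p ∈ S, Agg q p

/-- `H*_a(S) = inf_{q ∈ Γ̃(S)} H_a(q)`, the minimum Rényi entropy of couplings of `S`. -/
noncomputable def minRenyi {α : Type*} (S : Set (α → ℝ≥0∞)) (a : ℝ≥0∞) : ℝ≥0∞ :=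
  ⨅ (q : ℕ → ℝ≥0∞) (_ : UnderlyingCoupling S q), renyi q a

/-- The total mass of `f` lying above the level `t`, i.e. `Σ_x max(f(x) - t, 0)`. -/
noncomputable def excess {α : Type*} (f : α → ℝ) (t : ℝ) : ℝ := ∑' x, max (f x - t) 0

section Excess

variable {α β : Type*}

lemma summable_excess {f : α → ℝ} (hf : Summable f) (h0 : ∀ x, 0 ≤ f x) {t : ℝ} (ht : 0 ≤ t) :
    Summable fun x => max (f x - t) 0 :=
  hf.of_nonneg_of_le (fun _ => le_max_right _ _)
    fun x => max_le (by linarith) (h0 x)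

lemma excess_nonneg (f : α → ℝ) (t : ℝ) : 0 ≤ excess f t :=
  tsum_nonneg fun _ => le_max_right _ _

lemma finite_setOf_le_of_summable {f : α → ℝ} (hf : Summable f) {ε : ℝ} (hε : 0 < ε) :
    {x | ε ≤ f x}.Finite := by
  have h := hf.tendsto_cofinite_zero.eventually (gt_mem_nhds hε)
  rw [Filter.eventually_cofinite] at h
  simpa using h

lemma sum_sub_le_excess {f : α → ℝ} (hf : Summable f) (h0 : ∀ x, 0 ≤ f x) {t : ℝ} (ht : 0 ≤ t)
    (S : Finset α) : ∑ x ∈ S, (f x - t) ≤ excess f t :=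
  (Finset.sum_le_sum fun _ _ => le_max_left _ _).trans
    ((summable_excess hf h0 ht).sum_le_tsum S fun _ _ => le_max_right _ _)

lemma excess_eq_sum {f : α → ℝ} {t : ℝ} {S : Finset α} (h1 : ∀ x ∈ S, t ≤ f x)
    (h2 : ∀ x ∉ S, f x ≤ t) : excess f t = ∑ x ∈ S, (f x - t) := by
  unfold excess
  rw [tsum_eq_sum fun x hx => max_eq_right (by linarith [h2 x hx])]
  exact Finset.sum_congr rfl fun x hx => max_eq_left (by linarith [h1 x hx])

lemma excess_update {f : α → ℝ} (hf : Summable f) (h0 : ∀ x, 0 ≤ f x) {t : ℝ} (ht : 0 ≤ t)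
    (i : α) (v : ℝ) :
    excess (Function.update f i v) t = excess f t - max (f i - t) 0 + max (v - t) 0 := by
  have h := (summable_excess hf h0 ht).hasSum.update i (max (v - t) 0)
  have e : Function.update (fun x => max (f x - t) 0) i (max (v - t) 0) =
      fun x => max (Function.update f i v x - t) 0 := by
    funext x
    by_cases hx : x = i
    · subst hx; simp
    · simp [hx]
  rw [e] at h
  unfold excess
  rw [h.tsum_eq]
  ring

lemma exists_max_of_summable {f : α → ℝ} (hf : Summable f) {x₀ : α} (hx₀ : 0 < f x₀) :
    ∃ i, 0 < f i ∧ ∀ x, f x ≤ f i := by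
  obtain ⟨i, hi, hmax⟩ := Set.exists_max_image _ f (finite_setOf_le_of_summable hf hx₀)
    ⟨x₀, le_refl (f x₀)⟩
  refine ⟨i, hx₀.trans_le hi, fun x => ?_⟩
  rcases le_total (f x₀) (f x) with h | h
  · exact hmax x h
  · exact h.trans hi

/-- Removing half of a largest mass of `a` together with an equal amount of a suitable mass of
`b` preserves the domination of excesses. -/
lemma exists_halving {a : α → ℝ} {b : β → ℝ} (ha : Summable a) (ha0 : ∀ x, 0 ≤ a x)
    (hb : Summable b) (hb0 : ∀ y, 0 ≤ b y) (hab : ∀ t, 0 ≤ t → excess a t ≤ excess b t)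
    {i : α} {h : ℝ} (hi : a i = 2 * h) (hpos : 0 < h) (hmax : ∀ x, a x ≤ a i) :
    ∃ j, h ≤ b j ∧ ∀ t, 0 ≤ t →
      excess (Function.update a i h) t ≤ excess (Function.update b j (b j - h)) t := by
  by_cases hj : ∃ j, h ≤ b j ∧ b j ≤ 2 * h
  · obtain ⟨j, hj1, hj2⟩ := hj
    refine ⟨j, hj1, fun t ht => ?_⟩
    rw [excess_update ha ha0 ht, excess_update hb hb0 ht, hi]
    have := hab t ht
    rcases max_cases (2 * h - t) 0 with h1 | h1 <;> rcases max_cases (h - t) 0 with h2 | h2 <;>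
      rcases max_cases (b j - t) 0 with h3 | h3 <;>
      rcases max_cases (b j - h - t) 0 with h4 | h4 <;> linarith
  push Not at hj
  have hfin := finite_setOf_le_of_summable hb hpos
  set M := hfin.toFinset with hM
  have memM : ∀ y, y ∈ M ↔ h ≤ b y := fun y => by simp [hM]
  have hFb : ∀ t, h ≤ t → t ≤ 2 * h → excess b t = ∑ y ∈ M, (b y - t) := fun t h1 h2 =>
    excess_eq_sum (fun y hy => by linarith [hj y ((memM y).1 hy)])
      fun y hy => by rw [memM] at hy; linarith
  have hne : M.Nonempty := by
    by_contra hcon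
    rw [Finset.not_nonempty_iff_eq_empty] at hcon
    have h1 := hFb h le_rfl (by linarith)
    have h2 := sum_sub_le_excess ha ha0 hpos.le {i}
    have h3 := hab h hpos.le
    simp [hcon] at h1 h2
    linarith
  obtain ⟨j, hjM⟩ := hne
  have hjh := (memM j).1 hjM
  have hj2 := hj j hjh
  refine ⟨j, hjh, fun t ht => ?_⟩
  rw [excess_update ha ha0 ht, excess_update hb hb0 ht, hi]
  have habt := hab t ht
  rcases le_or_gt t h with hth | hth
  · rw [max_eq_left (by linarith), max_eq_left (by linarith), max_eq_left (by linarith),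
      max_eq_left (by linarith)]
    linarith
  rcases le_or_gt (2 * h) t with hth2 | hth2
  · have e : excess a t = 0 := by
      rw [excess_eq_sum (S := ∅) (by simp) (fun x _ => by linarith [hmax x])]
      simp
    rw [max_eq_right (by linarith : 2 * h - t ≤ 0), max_eq_right (by linarith : h - t ≤ 0), e,
      ← excess_update hb hb0 ht]
    simpa using excess_nonneg _ _
  rw [max_eq_left (by linarith : 0 ≤ 2 * h - t), max_eq_right (by linarith : h - t ≤ 0),
    max_eq_left (by linarith : 0 ≤ b j - t)]
  set S := (finite_setOf_le_of_summable ha (hpos.trans hth)).toFinset with hS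
  have memS : ∀ x, x ∈ S ↔ t ≤ a x := fun x => by simp [hS]
  have eS : excess a t = ∑ x ∈ S, (a x - t) :=
    excess_eq_sum (fun x hx => (memS x).1 hx) fun x hx => by rw [memS] at hx; linarith
  have eM := hFb t hth.le hth2.le
  rcases le_or_gt S.card M.card with hcard | hcard
  · have hc : (S.card : ℝ) ≤ M.card := by exact_mod_cast hcard
    have iS : i ∈ S := (memS i).2 (by linarith)
    have u : ∑ x ∈ S.erase i, (a x - t) ≤ ((S.card : ℝ) - 1) * (2 * h - t) := by
      have := Finset.sum_le_card_nsmul (S.erase i) (fun x => a x - t) (2 * h - t)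
        fun x _ => by linarith [hmax x]
      rwa [nsmul_eq_mul, Finset.cast_card_erase_of_mem iS] at this
    have l : ((M.card : ℝ) - 1) * (2 * h - t) ≤ ∑ y ∈ M.erase j, (b y - t) := by
      have := Finset.card_nsmul_le_sum (M.erase j) (fun y => b y - t) (2 * h - t)
        fun y hy => by linarith [hj y ((memM y).1 (Finset.mem_of_mem_erase hy))]
      rwa [nsmul_eq_mul, Finset.cast_card_erase_of_mem hjM] at this
    have s1 := Finset.add_sum_erase S (fun x => a x - t) iS
    have s2 := Finset.add_sum_erase M (fun y => b y - t) hjM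
    have := le_max_right (b j - h - t) 0
    nlinarith
  · have hc : (M.card : ℝ) + 1 ≤ S.card := by exact_mod_cast hcard
    have hA := (sum_sub_le_excess ha ha0 hpos.le S).trans (hab h hpos.le)
    rw [hFb h le_rfl (by linarith)] at hA
    rw [Finset.sum_sub_distrib] at hA eS eM
    rw [Finset.sum_sub_distrib] at hA
    simp only [Finset.sum_const, nsmul_eq_mul] at hA eS eM
    have := le_max_left (b j - h - t) 0
    nlinarith

end Excess

lemma IsPMF.ne_top {α : Type*} {p : α → ℝ≥0∞} (hp : IsPMF p) (x : α) : p x ≠ ∞ :=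
  ENNReal.ne_top_of_tsum_ne_top (by rw [hp]; simp) x

lemma IsPMF.summable_toReal {α : Type*} {p : α → ℝ≥0∞} (hp : IsPMF p) :
    Summable fun x => (p x).toReal :=
  ENNReal.summable_toReal (by rw [hp]; simp)

lemma Majorized.excess_le {α β : Type*} {q : α → ℝ≥0∞} {p : β → ℝ≥0∞} (hq : IsPMF q)
    (hp : IsPMF p) (hmaj : Majorized q p) {t : ℝ} (ht : 0 ≤ t) :
    excess (fun x => (q x).toReal) t ≤ excess (fun y => (p y).toReal) t := by
  refine (summable_excess hq.summable_toReal (fun _ => ENNReal.toReal_nonneg) ht).tsum_le_of_sum_le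
    fun A => ?_
  set B := A.filter fun x => t < (q x).toReal with hB
  have e1 : ∑ x ∈ A, max ((q x).toReal - t) 0 = ∑ x ∈ B, ((q x).toReal - t) := by
    rw [hB, Finset.sum_filter]
    refine Finset.sum_congr rfl fun x _ => ?_
    split_ifs with h
    · exact max_eq_left (by linarith)
    · exact max_eq_right (by linarith)
  set E := excess (fun y => (p y).toReal) t with hE
  have hE0 : 0 ≤ E + B.card * t := add_nonneg (excess_nonneg _ _) (by positivity)
  have h1 : ∑ x ∈ B, q x ≤ ENNReal.ofReal (E + B.card * t) := by
    refine (le_iSup₂ (f := fun (S : Finset α) (_ : S.card ≤ B.card) => ∑ x ∈ S, q x)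
      B le_rfl).trans ((hmaj B.card).trans (iSup₂_le fun C hC => ?_))
    rw [ENNReal.le_ofReal_iff_toReal_le (ENNReal.sum_ne_top.2 fun y _ => hp.ne_top y) hE0,
      ENNReal.toReal_sum fun y _ => hp.ne_top y]
    have h2 := sum_sub_le_excess hp.summable_toReal (fun _ => ENNReal.toReal_nonneg) ht C
    rw [Finset.sum_sub_distrib, Finset.sum_const, nsmul_eq_mul] at h2
    have h3 : (C.card : ℝ) * t ≤ B.card * t := by gcongr
    linarith
  rw [ENNReal.le_ofReal_iff_toReal_le (ENNReal.sum_ne_top.2 fun y _ => hq.ne_top y) hE0,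
    ENNReal.toReal_sum fun y _ => hq.ne_top y] at h1
  rw [e1, Finset.sum_sub_distrib, Finset.sum_const, nsmul_eq_mul]
  linarith

/-- A greedy allocation: `i n` is the mass that is halved at time `n`, `j n` is the mass of `p`
that the removed half goes to, `c n x` counts how often `x` has been halved before time `n`, and
`b n` is what is left of `p` at time `n`. -/
lemma exists_greedy_allocation {α β : Type*} {q : α → ℝ} {p : β → ℝ} (hq : Summable q)
    (hq0 : ∀ x, 0 ≤ q x) (hqpos : ∃ x, 0 < q x) (hp : Summable p) (hp0 : ∀ y, 0 ≤ p y)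
    (hqp : ∀ t, 0 ≤ t → excess q t ≤ excess p t) :
    ∃ (i : ℕ → α) (j : ℕ → β) (c : ℕ → α → ℕ) (b : ℕ → β → ℝ),
      c 0 = 0 ∧ b 0 = p ∧ (∀ n y, 0 ≤ b n y) ∧
      (∀ n, c (n + 1) = Function.update (c n) (i n) (c n (i n) + 1)) ∧
      (∀ n, b (n + 1) =
        Function.update (b n) (j n) (b n (j n) - q (i n) * 2⁻¹ ^ (c n (i n) + 1))) ∧
      (∀ n, 0 < q (i n)) ∧
      ∀ n x, q x * 2⁻¹ ^ c n x ≤ q (i n) * 2⁻¹ ^ c n (i n) := by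
  let Valid : (α → ℕ) × (β → ℝ) → Prop := fun s =>
    Summable s.2 ∧ (∀ y, 0 ≤ s.2 y) ∧
      ∀ t, 0 ≤ t → excess (fun x => q x * 2⁻¹ ^ s.1 x) t ≤ excess s.2 t
  have step : ∀ s : {s // Valid s}, ∃ (i : α) (j : β) (s' : {s // Valid s}),
      s'.1.1 = Function.update s.1.1 i (s.1.1 i + 1) ∧
      s'.1.2 = Function.update s.1.2 j (s.1.2 j - q i * 2⁻¹ ^ (s.1.1 i + 1)) ∧
      0 < q i ∧ ∀ x, q x * 2⁻¹ ^ s.1.1 x ≤ q i * 2⁻¹ ^ s.1.1 i := by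
    rintro ⟨⟨c, b⟩, hb, hb0, hab⟩
    simp only at hb hb0 hab ⊢
    have ha0 : ∀ x, 0 ≤ q x * 2⁻¹ ^ c x := fun x => mul_nonneg (hq0 x) (by positivity)
    have ha : Summable fun x => q x * 2⁻¹ ^ c x :=
      hq.of_nonneg_of_le ha0 fun x =>
        mul_le_of_le_one_right (hq0 x) (pow_le_one₀ (by norm_num) (by norm_num))
    obtain ⟨x₀, hx₀⟩ := hqpos
    obtain ⟨i, hi, hmax⟩ := exists_max_of_summable ha (x₀ := x₀) (by positivity)
    have hqi : 0 < q i := pos_of_mul_pos_left hi (by positivity)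
    obtain ⟨j, hj, hex⟩ := exists_halving ha ha0 hb hb0 hab (i := i)
      (h := q i * 2⁻¹ ^ (c i + 1)) (by rw [pow_succ]; ring) (by positivity) hmax
    refine ⟨i, j, ⟨⟨Function.update c i (c i + 1),
      Function.update b j (b j - q i * 2⁻¹ ^ (c i + 1))⟩, ?_, ?_, ?_⟩, rfl, rfl, hqi, hmax⟩
    · exact (hb.hasSum.update j _).summable
    · intro y
      by_cases hy : y = j
      · subst hy; simpa using hj
      · simpa [hy] using hb0 y
    · intro t ht
      have e : (fun x => q x * 2⁻¹ ^ Function.update c i (c i + 1) x) =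
          Function.update (fun x => q x * 2⁻¹ ^ c x) i (q i * 2⁻¹ ^ (c i + 1)) := by
        funext x
        by_cases hx : x = i
        · subst hx; simp
        · simp [hx]
      simpa only [e] using hex t ht
  choose i j next h1 h2 h3 h4 using step
  let s : ℕ → {s // Valid s} := fun n =>
    Nat.rec ⟨(0, p), hp, hp0, by simpa using hqp⟩ (fun _ s => next s) n
  exact ⟨fun n => i (s n), fun n => j (s n), fun n => (s n).1.1, fun n => (s n).1.2, rfl, rfl,
    fun n => (s n).2.2.1, fun n => h1 (s n), fun n => h2 (s n), fun n => h3 (s n),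
    fun n => h4 (s n)⟩

lemma tsum_geomHalf : ∑' k, geomHalf k = 1 := by
  unfold geomHalf
  rw [tsum_pnat_eq_tsum_succ (f := fun n => (2⁻¹ : ℝ≥0∞) ^ n), ENNReal.tsum_geometric_add_one]
  norm_num [ENNReal.one_sub_inv_two]
  exact ENNReal.inv_mul_cancel (by norm_num) (by norm_num)

lemma tsum_prodFun {α β : Type*} (q : α → ℝ≥0∞) (r : β → ℝ≥0∞) :
    ∑' z, prodFun q r z = (∑' x, q x) * ∑' y, r y := by
  rw [ENNReal.tsum_prod']
  simp only [prodFun, ENNReal.tsum_mul_left, ENNReal.tsum_mul_right]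

/-- An injective sequence of atoms exhausting the support of `Q`, together with a destination for
each of them such that no mass of `p` is exceeded, exhibits `p` as an aggregation of `Q`. -/
lemma agg_of_enumeration {γ β : Type*} {Q : γ → ℝ≥0∞} {p : β → ℝ≥0∞} (hQ : IsPMF Q)
    (hp : IsPMF p) {e : ℕ → γ} (he : Function.Injective e)
    (hrange : ∀ z, Q z ≠ 0 → z ∈ Set.range e)
    (j : ℕ → β) (hle : ∀ y, ∑' n, (if j n = y then Q (e n) else 0) ≤ p y) : Agg Q p := by
  have hg : ∀ n, Function.extend e j (fun _ => j 0) (e n) = j n := he.extend_apply _ _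
  set g := Function.extend e j (fun _ => j 0)
  have key : ∀ y, ∑' z, (if g z = y then Q z else 0) = ∑' n, if j n = y then Q (e n) else 0 := by
    intro y
    rw [← he.tsum_eq (f := fun z => if g z = y then Q z else 0)]
    · simp only [hg]
    · intro z hz
      refine hrange z fun h0 => hz ?_
      simp [h0]
  have heq : ∀ y, p y = ∑' z, if g z = y then Q z else 0 := by
    by_contra! hne
    obtain ⟨y, hy⟩ := hne
    have tot : ∑' y, ∑' z, (if g z = y then Q z else 0) = 1 := by
      rw [ENNReal.tsum_comm]
      simp only [tsum_ite_eq']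
      exact hQ
    have := ENNReal.tsum_lt_tsum (f := fun y => ∑' z, if g z = y then Q z else 0) (g := p) (i := y)
      (by rw [tot]; simp) (fun y => (key y).trans_le (hle y))
      (lt_of_le_of_ne ((key y).trans_le (hle y)) hy.symm)
    rw [tot, hp] at this
    exact lt_irrefl _ this
  refine ⟨g, fun z hz h0 => hz ?_, heq⟩
  have h1 := heq (g z)
  rw [h0, eq_comm, ENNReal.tsum_eq_zero] at h1
  simpa using h1 z

/-- Theorem 1, geometric splitting: if `q ⪯ p`, then
`q × Geom_{1/2} ⊑ p`. -/
theorem geometric_splitting {α β : Type*} [Countable α] [Countable β]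
    (q : α → ℝ≥0∞) (p : β → ℝ≥0∞) (hq : IsPMF q) (hp : IsPMF p)
    (hmaj : Majorized q p) :
    Agg (prodFun q geomHalf) p := by
  obtain ⟨x₀, hx₀⟩ : ∃ x, q x ≠ 0 := by
    by_contra! h
    simp [IsPMF, h] at hq
  obtain ⟨i, j, c, b, hc0, hb0, hb, hc, hbs, hqi, hmax⟩ :=
    exists_greedy_allocation hq.summable_toReal (fun _ => ENNReal.toReal_nonneg)
      ⟨x₀, ENNReal.toReal_pos hx₀ (hq.ne_top _)⟩ hp.summable_toReal
      (fun _ => ENNReal.toReal_nonneg) fun t ht => hmaj.excess_le hq hp ht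
  have hQ : IsPMF (prodFun q geomHalf) := by
    rw [IsPMF, tsum_prodFun, hq, tsum_geomHalf, one_mul]
  have hcmono : ∀ x, Monotone fun n => c n x := fun x => monotone_nat_of_le_succ fun n => by
    rw [hc]
    by_cases hx : x = i n
    · subst hx; simp
    · simp [hx]
  let e : ℕ → α × ℕ+ := fun n => (i n, (c n (i n)).succPNat)
  have hQe : ∀ n, prodFun q geomHalf (e n) =
      ENNReal.ofReal ((q (i n)).toReal * 2⁻¹ ^ (c n (i n) + 1)) := fun n => by
    rw [ENNReal.ofReal_mul ENNReal.toReal_nonneg, ENNReal.ofReal_toReal (hq.ne_top _),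
      ENNReal.ofReal_pow (by norm_num), ENNReal.ofReal_inv_of_pos (by norm_num)]
    simp [prodFun, geomHalf, e]
  have he : Function.Injective e := by
    refine Function.Injective.of_lt_imp_ne fun m n hmn hemn => ?_
    have h1 : i m = i n := congrArg Prod.fst hemn
    have h2 : c m (i m) = c n (i n) := Nat.succPNat_injective (congrArg Prod.snd hemn)
    have h3 := hcmono (i m) (Nat.succ_le_of_lt hmn)
    simp only [Nat.succ_eq_add_one, hc m, Function.update_self] at h3
    rw [h2, h1] at h3
    omega
  refine agg_of_enumeration hQ hp he ?_ j fun y => ?_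
  · rintro ⟨x, k⟩ hz
    by_contra hk
    have hqx : q x ≠ 0 := fun h => hz (by simp [prodFun, h])
    have hbound : ∀ n, c n x ≤ k.natPred := by
      intro n
      induction n with
      | zero => simp [hc0]
      | succ n ih =>
        rw [hc]
        by_cases hx : x = i n
        · subst hx
          refine Function.update_self (i n) _ (c n) ▸ Nat.succ_le_of_lt (lt_of_le_of_ne ih ?_)
          intro h
          exact hk ⟨n, by simp [e, h]⟩
        · simpa [hx] using ih
    set ε : ℝ := (q x).toReal * 2⁻¹ ^ (k.natPred + 1) with hε
    have hεpos : 0 < ε := mul_pos (ENNReal.toReal_pos hqx (hq.ne_top _)) (by positivity)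
    have hlarge : ∀ n, ENNReal.ofReal ε ≤ prodFun q geomHalf (e n) := fun n => by
      rw [hQe]
      refine ENNReal.ofReal_le_ofReal ?_
      have h1 := hmax n x
      have h2 : (2⁻¹ : ℝ) ^ k.natPred ≤ 2⁻¹ ^ c n x :=
        pow_le_pow_of_le_one (by norm_num) (by norm_num) (hbound n)
      have h3 := mul_le_mul_of_nonneg_left h2 (ENNReal.toReal_nonneg (a := q x))
      rw [hε, pow_succ, pow_succ]
      linarith
    have h1 := (ENNReal.tsum_le_tsum hlarge).trans
      (ENNReal.tsum_comp_le_tsum_of_injective he (prodFun q geomHalf))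
    rw [hQ, ENNReal.tsum_const_eq_top_of_ne_zero (by simpa using hεpos)] at h1
    simp at h1
  · have hinv : ∀ n, ENNReal.ofReal (b n y) +
        ∑ m ∈ Finset.range n, (if j m = y then prodFun q geomHalf (e m) else 0) = p y := by
      intro n
      induction n with
      | zero => simp [hb0, hp.ne_top]
      | succ n ih =>
        rw [Finset.sum_range_succ, add_comm (Finset.sum _ _), ← add_assoc]
        rw [← ih]
        congr 1
        split_ifs with hy
        · subst hy
          have hnn := hb (n + 1) (j n)
          have hbn : b (n + 1) (j n) = _ := congrFun (hbs n) (j n)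
          rw [Function.update_self] at hbn
          rw [hQe, ← ENNReal.ofReal_add hnn (by positivity), hbn]
          congr 1
          ring
        · rw [hbs, Function.update_of_ne (Ne.symm hy), add_zero]
    rw [ENNReal.tsum_eq_iSup_nat]
    exact iSup_le fun n => (hinv n).symm ▸ le_add_self

end MEC
end

section
/- Let S be a set of pmfs such that ⋀S exists, and let α ∈ [0,∞]. Then every underlying distribution q ∈ Γ̃(S) of a coupling of S satisfies q ⪯ ⋀S, and consequently H_α(q) ≥ H_α(⋀S); hence H*_α(S) ≥ H_α(⋀S). -/
open scoped ENNReal Classical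
open Filter

namespace MEC

open MeasureTheory

section Majorization

variable {ι κ : Type*}

lemma sum_le_topk (p : ι → ℝ≥0∞) {A : Finset ι} {k : ℕ} (hA : A.card ≤ k) :
    ∑ x ∈ A, p x ≤ topk p k :=
  le_iSup₂ (f := fun (A : Finset ι) (_ : A.card ≤ k) => ∑ x ∈ A, p x) A hA

lemma topk_zero (p : ι → ℝ≥0∞) : topk p 0 = 0 := by
  simp [topk]

lemma topk_mono (p : ι → ℝ≥0∞) : Monotone (topk p) := fun _ _ h =>
  iSup₂_le fun _ hA => sum_le_topk p (hA.trans h)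

lemma topk_one (p : ι → ℝ≥0∞) : topk p 1 = ⨆ x, p x := by
  apply le_antisymm
  · refine iSup₂_le fun A hA => ?_
    rcases A.eq_empty_or_nonempty with rfl | hne
    · simp
    · obtain ⟨x, rfl⟩ := Finset.card_eq_one.1 (le_antisymm hA hne.card_pos)
      simpa using le_iSup p x
  · exact iSup_le fun x => by simpa using sum_le_topk p (A := {x}) (k := 1) (by simp)

lemma IsPMF.le_one {p : ι → ℝ≥0∞} (hp : IsPMF p) (x : ι) : p x ≤ 1 :=
  (ENNReal.le_tsum x).trans hp.le

/-- Aggregating a distribution can only increase its sums of largest masses. -/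
lemma Agg.majorized {q : ι → ℝ≥0∞} {p : κ → ℝ≥0∞} (h : Agg q p) : Majorized q p := by
  obtain ⟨g, -, hg⟩ := h
  intro k
  refine iSup₂_le fun A hA => ?_
  refine le_trans ?_ (sum_le_topk p (Finset.card_image_le.trans hA : (A.image g).card ≤ k))
  rw [← Finset.sum_fiberwise_of_maps_to (fun x hx => Finset.mem_image_of_mem g hx)]
  refine Finset.sum_le_sum fun y _ => ?_
  rw [hg y, Finset.sum_filter]
  exact ENNReal.sum_le_tsum A

lemma topk_le_tsum_sub_add (p : ι → ℝ≥0∞) (k : ℕ) (t : ℝ≥0∞) :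
    topk p k ≤ ∑' x, (p x - t) + k * t := by
  refine iSup₂_le fun A hA => ?_
  calc ∑ x ∈ A, p x ≤ ∑ x ∈ A, ((p x - t) + t) := Finset.sum_le_sum fun x _ => le_tsub_add
    _ = ∑ x ∈ A, (p x - t) + A.card * t := by simp [Finset.sum_add_distrib]
    _ ≤ _ := by gcongr; exact ENNReal.sum_le_tsum A

/-- Majorization implies domination of all sums of positive parts. -/
lemma Majorized.tsum_sub_le {q : ι → ℝ≥0∞} {p : κ → ℝ≥0∞} (h : Majorized q p) (t : ℝ≥0∞) :
    ∑' x, (q x - t) ≤ ∑' x, (p x - t) := by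
  rcases eq_or_ne t ∞ with rfl | ht
  · simp
  rw [ENNReal.tsum_eq_iSup_sum]
  refine iSup_le fun A => ?_
  set B := A.filter fun x => t ≤ q x with hB
  have h1 : ∑ x ∈ A, (q x - t) = ∑ x ∈ B, (q x - t) := by
    symm
    refine Finset.sum_subset (Finset.filter_subset _ _) fun x hx hxB => ?_
    simp only [hB, Finset.mem_filter, hx, true_and, not_le] at hxB
    exact tsub_eq_zero_of_le hxB.le
  have h2 : ∑ x ∈ B, (q x - t) + B.card * t = ∑ x ∈ B, q x := by
    rw [← nsmul_eq_mul, ← Finset.sum_const, ← Finset.sum_add_distrib]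
    exact Finset.sum_congr rfl fun x hx => tsub_add_cancel_of_le (Finset.mem_filter.1 hx).2
  have hfin : (B.card : ℝ≥0∞) * t ≠ ∞ := ENNReal.mul_ne_top (ENNReal.natCast_ne_top _) ht
  rw [h1, ← ENNReal.add_le_add_iff_right hfin, h2]
  exact ((sum_le_topk q le_rfl).trans (h _)).trans (topk_le_tsum_sub_add p _ t)

lemma tsum_min_add_tsum_sub (p : ι → ℝ≥0∞) (t : ℝ≥0∞) :
    ∑' x, min (p x) t + ∑' x, (p x - t) = ∑' x, p x := by
  rw [← ENNReal.tsum_add]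
  refine tsum_congr fun x => ?_
  rcases le_total (p x) t with hx | hx
  · simp [hx, tsub_eq_zero_of_le hx]
  · simp [hx, add_tsub_cancel_of_le hx]

lemma Majorized.tsum_min_le {q : ι → ℝ≥0∞} {p : κ → ℝ≥0∞} (h : Majorized q p)
    (hq : IsPMF q) (hp : IsPMF p) (t : ℝ≥0∞) :
    ∑' x, min (p x) t ≤ ∑' x, min (q x) t := by
  have hfin : ∑' x, (p x - t) ≠ ∞ :=
    ne_top_of_le_ne_top (hp.symm ▸ ENNReal.one_ne_top)
      (ENNReal.tsum_le_tsum fun x => tsub_le_self)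
  rw [← ENNReal.add_le_add_iff_right hfin, tsum_min_add_tsum_sub, hp, ← hq,
    ← tsum_min_add_tsum_sub q t]
  gcongr
  exact h.tsum_sub_le t

lemma tsum_lintegral_le_tsum_lintegral [Countable ι] [Countable κ] {q : ι → ℝ≥0∞}
    {p : κ → ℝ≥0∞} {μ : Measure ℝ} {K : ℝ≥0∞ → ℝ → ℝ≥0∞} {w : ℝ → ℝ≥0∞}
    (hK : ∀ x, Measurable (K x)) (hw : Measurable w)
    (h : ∀ t, ∑' x, K (p x) t ≤ ∑' x, K (q x) t) :
    ∑' x, ∫⁻ t, K (p x) t * w t ∂μ ≤ ∑' x, ∫⁻ t, K (q x) t * w t ∂μ := by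
  have hm (x : ℝ≥0∞) : AEMeasurable (fun t => K x t * w t) μ := ((hK x).mul hw).aemeasurable
  rw [← lintegral_tsum fun x => hm (p x), ← lintegral_tsum fun x => hm (q x)]
  refine lintegral_mono fun t => ?_
  simp only [ENNReal.tsum_mul_right]
  gcongr
  exact h t

end Majorization

section Integrals

lemma lintegral_Ioc_rpow {s y : ℝ} (hs : -1 < s) (hy : 0 ≤ y) :
    ∫⁻ t in Set.Ioc 0 y, ENNReal.ofReal (t ^ s) = ENNReal.ofReal (y ^ (s + 1) / (s + 1)) := by
  have hi := (intervalIntegral.intervalIntegrable_rpow' (a := 0) (b := y) hs)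
  rw [intervalIntegrable_iff_integrableOn_Ioc_of_le hy] at hi
  rw [← ofReal_integral_eq_lintegral_ofReal hi, ← intervalIntegral.integral_of_le hy,
    integral_rpow (Or.inl hs), Real.zero_rpow (by linarith), sub_zero]
  exact (ae_restrict_iff' measurableSet_Ioc).2 (ae_of_all _ fun t ht => Real.rpow_nonneg ht.1.le _)

lemma lintegral_Ioi_rpow {s y : ℝ} (hs : s < -1) (hy : 0 < y) :
    ∫⁻ t in Set.Ioi y, ENNReal.ofReal (t ^ s) = ENNReal.ofReal (-y ^ (s + 1) / (s + 1)) := by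
  rw [← ofReal_integral_eq_lintegral_ofReal (integrableOn_Ioi_rpow_of_lt hs hy),
    integral_Ioi_rpow_of_lt hs hy]
  exact (ae_restrict_iff' measurableSet_Ioi).2
    (ae_of_all _ fun t ht => Real.rpow_nonneg (hy.trans ht).le _)

lemma lintegral_min_mul_rpow {r : ℝ} (h0 : 0 < r) (h1 : r < 1) {x : ℝ≥0∞} (hx : x ≠ ∞) :
    ∫⁻ t in Set.Ioi (0 : ℝ), min x (ENNReal.ofReal t) * ENNReal.ofReal (t ^ (r - 2)) =
      x ^ r * ENNReal.ofReal (1 / r + 1 / (1 - r)) := by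
  lift x to NNReal using hx
  rcases eq_or_ne x 0 with rfl | hx0
  · simp [h0]
  have hy : (0 : ℝ) < x := by positivity
  rw [← Set.Ioc_union_Ioi_eq_Ioi hy.le,
    lintegral_union measurableSet_Ioi (Set.Ioc_disjoint_Ioi le_rfl)]
  have e1 : ∫⁻ t in Set.Ioc (0 : ℝ) x, min (x : ℝ≥0∞) (ENNReal.ofReal t) *
      ENNReal.ofReal (t ^ (r - 2)) = ENNReal.ofReal ((x : ℝ) ^ r / r) := by
    rw [setLIntegral_congr_fun (g := fun t => ENNReal.ofReal (t ^ (r - 1))) measurableSet_Ioc,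
      lintegral_Ioc_rpow (by linarith) hy.le, sub_add_cancel]
    intro t ht
    have hm : min (x : ℝ≥0∞) (ENNReal.ofReal t) = ENNReal.ofReal t :=
      min_eq_right (by rw [← ENNReal.ofReal_coe_nnreal]; exact ENNReal.ofReal_le_ofReal ht.2)
    simp only [hm]
    rw [← ENNReal.ofReal_mul ht.1.le, show r - 1 = 1 + (r - 2) by ring, Real.rpow_add ht.1,
      Real.rpow_one]
  have e2 : ∫⁻ t in Set.Ioi (x : ℝ), min (x : ℝ≥0∞) (ENNReal.ofReal t) *
      ENNReal.ofReal (t ^ (r - 2)) = ENNReal.ofReal ((x : ℝ) ^ r / (1 - r)) := by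
    rw [setLIntegral_congr_fun (g := fun t => (x : ℝ≥0∞) * ENNReal.ofReal (t ^ (r - 2)))
      measurableSet_Ioi, lintegral_const_mul' _ _ ENNReal.coe_ne_top,
      lintegral_Ioi_rpow (by linarith) hy, ← ENNReal.ofReal_coe_nnreal,
      ← ENNReal.ofReal_mul hy.le]
    · congr 1
      rw [show r - 2 + 1 = r - 1 by ring, Real.rpow_sub_one hy.ne']
      have : 1 - r ≠ 0 := by linarith
      have : r - 1 ≠ 0 := by linarith
      field_simp
      ring
    · intro t ht
      have hm : min (x : ℝ≥0∞) (ENNReal.ofReal t) = x :=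
        min_eq_left (by rw [← ENNReal.ofReal_coe_nnreal]; exact ENNReal.ofReal_le_ofReal ht.le)
      simp only [hm]
  have hr : 0 < 1 - r := by linarith
  rw [e1, e2, ← ENNReal.ofReal_add (by positivity) (by positivity), ← ENNReal.ofReal_coe_nnreal,
    ENNReal.ofReal_rpow_of_pos hy, ← ENNReal.ofReal_mul (by positivity)]
  congr 1
  ring

lemma lintegral_sub_mul_rpow {r : ℝ} (h1 : 1 < r) {x : ℝ≥0∞} (hx : x ≠ ∞) :
    ∫⁻ t in Set.Ioi (0 : ℝ), (x - ENNReal.ofReal t) * ENNReal.ofReal (t ^ (r - 2)) =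
      x ^ r * ENNReal.ofReal (1 / (r - 1) - 1 / r) := by
  lift x to NNReal using hx
  have hr : 0 < r - 1 := by linarith
  rcases eq_or_ne x 0 with rfl | hx0
  · simp [show 0 < r by linarith]
  have hy : (0 : ℝ) < x := by positivity
  rw [← Set.Ioc_union_Ioi_eq_Ioi hy.le,
    lintegral_union measurableSet_Ioi (Set.Ioc_disjoint_Ioi le_rfl)]
  have e2 : ∫⁻ t in Set.Ioi (x : ℝ), ((x : ℝ≥0∞) - ENNReal.ofReal t) *
      ENNReal.ofReal (t ^ (r - 2)) = 0 := by
    rw [setLIntegral_congr_fun (g := fun _ => 0) measurableSet_Ioi, lintegral_zero]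
    intro t ht
    have hm : (x : ℝ≥0∞) - ENNReal.ofReal t = 0 :=
      tsub_eq_zero_of_le
        (by rw [← ENNReal.ofReal_coe_nnreal]; exact ENNReal.ofReal_le_ofReal ht.le)
    simp only [hm, zero_mul]
  have e1 : (∫⁻ t in Set.Ioc (0 : ℝ) x, ((x : ℝ≥0∞) - ENNReal.ofReal t) *
      ENNReal.ofReal (t ^ (r - 2))) + ENNReal.ofReal ((x : ℝ) ^ r / r) =
      ENNReal.ofReal ((x : ℝ) ^ r / (r - 1)) := by
    have e3 : ENNReal.ofReal ((x : ℝ) ^ r / r) =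
        ∫⁻ t in Set.Ioc (0 : ℝ) x, ENNReal.ofReal (t ^ (r - 1)) := by
      rw [lintegral_Ioc_rpow (by linarith) hy.le, sub_add_cancel]
    rw [e3, ← lintegral_add_right _ (by fun_prop),
      setLIntegral_congr_fun (g := fun t => (x : ℝ≥0∞) * ENNReal.ofReal (t ^ (r - 2)))
      measurableSet_Ioc, lintegral_const_mul' _ _ ENNReal.coe_ne_top,
      lintegral_Ioc_rpow (by linarith) hy.le, ← ENNReal.ofReal_coe_nnreal,
      ← ENNReal.ofReal_mul hy.le]
    · congr 1
      rw [show r - 2 + 1 = r - 1 by ring, Real.rpow_sub_one hy.ne']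
      field_simp
    · intro t ht
      simp only
      rw [show r - 1 = 1 + (r - 2) by ring, Real.rpow_add ht.1, Real.rpow_one,
        ENNReal.ofReal_mul ht.1.le, ← add_mul, tsub_add_cancel_of_le]
      rw [← ENNReal.ofReal_coe_nnreal]
      exact ENNReal.ofReal_le_ofReal ht.2
  rw [e2, add_zero, ENNReal.eq_sub_of_add_eq ENNReal.ofReal_ne_top e1,
    ← ENNReal.ofReal_sub _ (by positivity), ← ENNReal.ofReal_coe_nnreal,
    ENNReal.ofReal_rpow_of_pos hy, ← ENNReal.ofReal_mul (by positivity)]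
  congr 1
  ring

lemma lintegral_min_mul_inv {x : ℝ≥0∞} (hx : x ≤ 1) :
    ∫⁻ t in Set.Ioc (0 : ℝ) 1, min x (ENNReal.ofReal t) * ENNReal.ofReal t⁻¹ =
      x + x * log2 x⁻¹ * ENNReal.ofReal (Real.log 2) := by
  lift x to NNReal using ne_top_of_le_ne_top ENNReal.one_ne_top hx
  rcases eq_or_ne x 0 with rfl | hx0
  · simp
  have hy : (0 : ℝ) < x := by positivity
  have hy1 : (x : ℝ) ≤ 1 := by exact_mod_cast hx
  rw [← Set.Ioc_union_Ioc_eq_Ioc hy.le hy1,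
    lintegral_union measurableSet_Ioc (Set.Ioc_disjoint_Ioc_of_le le_rfl)]
  congr 1
  · rw [setLIntegral_congr_fun (g := fun _ => 1) measurableSet_Ioc]
    · simp
    intro t ht
    have hm : min (x : ℝ≥0∞) (ENNReal.ofReal t) = ENNReal.ofReal t :=
      min_eq_right (by rw [← ENNReal.ofReal_coe_nnreal]; exact ENNReal.ofReal_le_ofReal ht.2)
    simp only [hm]
    rw [← ENNReal.ofReal_mul ht.1.le, mul_inv_cancel₀ ht.1.ne', ENNReal.ofReal_one]
  · have hi : IntervalIntegrable (fun t : ℝ => t⁻¹) volume x 1 := by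
      rw [intervalIntegrable_inv_iff]
      right
      rw [Set.uIcc_of_le hy1]
      exact fun h => hy.not_ge h.1
    rw [intervalIntegrable_iff_integrableOn_Ioc_of_le hy1] at hi
    rw [setLIntegral_congr_fun (g := fun t => (x : ℝ≥0∞) * ENNReal.ofReal t⁻¹)
      measurableSet_Ioc, lintegral_const_mul' _ _ ENNReal.coe_ne_top,
      ← ofReal_integral_eq_lintegral_ofReal hi, ← intervalIntegral.integral_of_le hy1,
      integral_inv_of_pos hy one_pos, mul_assoc]
    · congr 1
      have hne : ((x : ℝ≥0∞))⁻¹ ≠ ∞ := by simpa using hx0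
      rw [log2, if_neg hne, ← ENNReal.ofReal_mul' (Real.log_nonneg one_le_two), Real.logb,
        div_mul_cancel₀ _ (Real.log_pos one_lt_two).ne', ENNReal.toReal_inv]
      simp
    · exact (ae_restrict_iff' measurableSet_Ioc).2
        (ae_of_all _ fun t ht => inv_nonneg.2 (hy.trans ht.1).le)
    · intro t ht
      have hm : min (x : ℝ≥0∞) (ENNReal.ofReal t) = x :=
        min_eq_left (by rw [← ENNReal.ofReal_coe_nnreal]; exact ENNReal.ofReal_le_ofReal ht.1.le)
      simp only [hm]

end Integrals

section SchurConcavity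

variable {ι κ : Type*} {q : ι → ℝ≥0∞} {p : κ → ℝ≥0∞}

lemma log2_mono : Monotone log2 := by
  intro x y h
  unfold log2
  by_cases hy : y = ∞
  · simp [hy]
  have hx : x ≠ ∞ := ne_top_of_le_ne_top hy h
  rw [if_neg hx, if_neg hy]
  rcases eq_or_ne x 0 with rfl | hx0
  · simp
  exact ENNReal.ofReal_le_ofReal (Real.logb_le_logb_of_le one_lt_two
    (ENNReal.toReal_pos hx0 hx) (ENNReal.toReal_mono hy h))

lemma ite_eq_zero_rpow {r : ℝ} (hr : 0 < r) (x : ℝ≥0∞) :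
    (if x = 0 then 0 else x ^ r) = x ^ r := by
  split_ifs with h
  · simp [h, hr]
  · rfl

lemma Majorized.shannon_le [Countable ι] [Countable κ] (h : Majorized q p) (hq : IsPMF q)
    (hp : IsPMF p) : shannon p ≤ shannon q := by
  have key := tsum_lintegral_le_tsum_lintegral (q := q) (p := p)
    (μ := volume.restrict (Set.Ioc (0 : ℝ) 1)) (K := fun x t => min x (ENNReal.ofReal t))
    (w := fun t => ENNReal.ofReal t⁻¹) (fun x => by fun_prop) (by fun_prop)
    fun t => h.tsum_min_le hq hp _
  simp only [lintegral_min_mul_inv (hp.le_one _), lintegral_min_mul_inv (hq.le_one _),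
    ENNReal.tsum_add, ENNReal.tsum_mul_right] at key
  rw [hp, hq, ENNReal.add_le_add_iff_left ENNReal.one_ne_top] at key
  exact (ENNReal.mul_le_mul_iff_left (by simp [Real.log_pos one_lt_two])
    ENNReal.ofReal_ne_top).1 key

lemma Majorized.tsum_rpow_le_of_lt_one [Countable ι] [Countable κ] (h : Majorized q p)
    (hq : IsPMF q) (hp : IsPMF p) {r : ℝ} (h0 : 0 < r) (h1 : r < 1) :
    ∑' x, p x ^ r ≤ ∑' x, q x ^ r := by
  have key := tsum_lintegral_le_tsum_lintegral (q := q) (p := p)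
    (μ := volume.restrict (Set.Ioi (0 : ℝ))) (K := fun x t => min x (ENNReal.ofReal t))
    (w := fun t => ENNReal.ofReal (t ^ (r - 2))) (fun x => by fun_prop) (by fun_prop)
    fun t => h.tsum_min_le hq hp _
  have hpt x : p x ≠ ∞ := ne_top_of_le_ne_top ENNReal.one_ne_top (hp.le_one x)
  have hqt x : q x ≠ ∞ := ne_top_of_le_ne_top ENNReal.one_ne_top (hq.le_one x)
  simp only [lintegral_min_mul_rpow h0 h1 (hpt _), lintegral_min_mul_rpow h0 h1 (hqt _),
    ENNReal.tsum_mul_right] at key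
  have hr : 0 < 1 - r := by linarith
  have hc : 0 < 1 / r + 1 / (1 - r) := by positivity
  exact (ENNReal.mul_le_mul_iff_left (ENNReal.ofReal_pos.2 hc).ne' ENNReal.ofReal_ne_top).1 key

lemma Majorized.tsum_rpow_le_of_one_lt [Countable ι] [Countable κ] (h : Majorized q p)
    (hq : IsPMF q) (hp : IsPMF p) {r : ℝ} (h1 : 1 < r) :
    ∑' x, q x ^ r ≤ ∑' x, p x ^ r := by
  have key := tsum_lintegral_le_tsum_lintegral (q := p) (p := q)
    (μ := volume.restrict (Set.Ioi (0 : ℝ))) (K := fun x t => x - ENNReal.ofReal t)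
    (w := fun t => ENNReal.ofReal (t ^ (r - 2))) (fun x => by fun_prop) (by fun_prop)
    fun t => h.tsum_sub_le _
  have hpt x : p x ≠ ∞ := ne_top_of_le_ne_top ENNReal.one_ne_top (hp.le_one x)
  have hqt x : q x ≠ ∞ := ne_top_of_le_ne_top ENNReal.one_ne_top (hq.le_one x)
  simp only [lintegral_sub_mul_rpow h1 (hpt _), lintegral_sub_mul_rpow h1 (hqt _),
    ENNReal.tsum_mul_right] at key
  have hc : 0 < 1 / (r - 1) - 1 / r :=
    sub_pos.2 (one_div_lt_one_div_of_lt (by linarith) (by linarith))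
  exact (ENNReal.mul_le_mul_iff_left (ENNReal.ofReal_pos.2 hc).ne' ENNReal.ofReal_ne_top).1 key

/-- A majorizing pmf has the smaller support. -/
lemma Majorized.tsum_support_le (h : Majorized q p) (hq : IsPMF q) (hp : IsPMF p) :
    ∑' x, (if p x = 0 then 0 else 1 : ℝ≥0∞) ≤ ∑' x, (if q x = 0 then 0 else 1 : ℝ≥0∞) := by
  rw [ENNReal.tsum_eq_iSup_sum]
  refine iSup_le fun A => ?_
  set B := A.filter fun x => p x ≠ 0 with hB
  have hA : ∑ x ∈ A, (if p x = 0 then 0 else 1 : ℝ≥0∞) = B.card := by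
    simp [hB, Finset.sum_ite]
  rw [hA]
  rcases B.eq_empty_or_nonempty with he | hne
  · simp [he]
  obtain ⟨y, hy, hmin⟩ := B.exists_min_image p hne
  have hy0 : p y ≠ 0 := (Finset.mem_filter.1 hy).2
  have hyt : p y ≠ ∞ := ne_top_of_le_ne_top ENNReal.one_ne_top (hp.le_one y)
  rw [← ENNReal.mul_le_mul_iff_left hy0 hyt]
  calc (B.card : ℝ≥0∞) * p y = ∑ x ∈ B, min (p x) (p y) := by
        rw [Finset.sum_congr rfl fun x hx => min_eq_right (hmin x hx)]; simp
    _ ≤ ∑' x, min (p x) (p y) := ENNReal.sum_le_tsum B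
    _ ≤ ∑' x, min (q x) (p y) := h.tsum_min_le hq hp _
    _ ≤ ∑' x, (if q x = 0 then 0 else 1) * p y := by
        refine ENNReal.tsum_le_tsum fun x => ?_
        split_ifs with hx <;> simp [hx]
    _ = _ := ENNReal.tsum_mul_right

/-- Schur concavity of the Rényi entropies. -/
lemma Majorized.renyi_le [Countable ι] [Countable κ] (h : Majorized q p)
    (hq : IsPMF q) (hp : IsPMF p) (a : ℝ≥0∞) : renyi p a ≤ renyi q a := by
  unfold renyi
  split_ifs with h1 htop hlt
  · exact h.shannon_le hq hp
  · apply log2_mono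
    rw [ENNReal.inv_le_inv, ← topk_one, ← topk_one]
    exact h 1
  · gcongr
    apply log2_mono
    rcases eq_or_ne a 0 with rfl | ha0
    · simpa using h.tsum_support_le hq hp
    · have ha : 0 < a.toReal := ENNReal.toReal_pos ha0 htop
      simp only [ite_eq_zero_rpow ha]
      refine h.tsum_rpow_le_of_lt_one hq hp ha ?_
      simpa using (ENNReal.toReal_lt_toReal htop ENNReal.one_ne_top).2 hlt
  · have ha : 1 < a.toReal := by
      simpa using (ENNReal.toReal_lt_toReal ENNReal.one_ne_top htop).2
        (lt_of_le_of_ne (not_lt.1 hlt) (Ne.symm h1))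
    gcongr
    apply log2_mono
    rw [ENNReal.inv_le_inv]
    simp only [ite_eq_zero_rpow (one_pos.trans ha)]
    exact h.tsum_rpow_le_of_one_lt hq hp ha

end SchurConcavity

section GreatestLowerBound

variable {α : Type*} {S : Set (α → ℝ≥0∞)}

lemma infTopk_mono (S : Set (α → ℝ≥0∞)) : Monotone (infTopk S) := fun _ _ h =>
  iInf₂_mono fun p _ => topk_mono p h

lemma GlbExists.nonempty (hex : GlbExists S) : S.Nonempty := by
  by_contra hne
  rw [Set.not_nonempty_iff_eq_empty] at hne
  subst hne
  have h : (fun k => infTopk (∅ : Set (α → ℝ≥0∞)) k) = fun _ => ∞ := by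
    funext k
    simp [infTopk]
  rw [GlbExists, h] at hex
  exact ENNReal.one_ne_top (tendsto_nhds_unique hex tendsto_const_nhds)

lemma infTopk_zero (hne : S.Nonempty) : infTopk S 0 = 0 := by
  obtain ⟨p, hp⟩ := hne
  exact le_antisymm ((iInf₂_le p hp).trans (topk_zero p).le) bot_le

lemma sum_range_glb (hne : S.Nonempty) (n : ℕ) :
    ∑ i ∈ Finset.range n, glb S i.succPNat = infTopk S n := by
  induction n with
  | zero => simp [infTopk_zero hne]
  | succ n ih =>
    rw [Finset.sum_range_succ, ih, glb, Nat.succPNat_coe, Nat.succ_sub_one]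
    exact add_tsub_cancel_of_le (infTopk_mono S n.le_succ)

lemma isPMF_glb (hex : GlbExists S) : IsPMF (glb S) := by
  rw [IsPMF, ← Equiv.pnatEquivNat.symm.tsum_eq]
  have h := ENNReal.tendsto_nat_tsum fun i : ℕ => glb S i.succPNat
  simp only [sum_range_glb hex.nonempty] at h
  exact tendsto_nhds_unique h hex

lemma infTopk_le_topk_glb (hne : S.Nonempty) (k : ℕ) : infTopk S k ≤ topk (glb S) k := by
  rw [← sum_range_glb hne, ← Finset.sum_image (f := glb S) (g := Nat.succPNat)
    fun _ _ _ _ h => Nat.succPNat_injective h]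
  exact sum_le_topk _ (Finset.card_image_le.trans (Finset.card_range k).le)

lemma UnderlyingCoupling.majorized_glb {q : ℕ → ℝ≥0∞} (hq : UnderlyingCoupling S q)
    (hne : S.Nonempty) : Majorized q (glb S) := fun k =>
  (le_iInf₂ fun p hp => (hq.2 p hp).majorized k).trans (infTopk_le_topk_glb hne k)

end GreatestLowerBound

/-- if `⋀S` exists, every underlying distribution `q ∈ Γ̃(S)` of a
coupling of `S` satisfies `q ⪯ ⋀S`, hence `H_a(q) ≥ H_a(⋀S)`; consequently
`H*_a(S) ≥ H_a(⋀S)`. -/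
theorem coupling_majorized_by_glb {α : Type*} [Countable α]
    (S : Set (α → ℝ≥0∞)) (hS : ∀ p ∈ S, IsPMF p) (hex : GlbExists S) (a : ℝ≥0∞) :
    (∀ q : ℕ → ℝ≥0∞, UnderlyingCoupling S q →
      Majorized q (glb S) ∧ renyi (glb S) a ≤ renyi q a) ∧
    renyi (glb S) a ≤ minRenyi S a := by
  have h : ∀ q : ℕ → ℝ≥0∞, UnderlyingCoupling S q →
      Majorized q (glb S) ∧ renyi (glb S) a ≤ renyi q a := fun q hq =>
    have hm := hq.majorized_glb hex.nonempty
    ⟨hm, hm.renyi_le hq.1 (isPMF_glb hex) a⟩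
  exact ⟨h, le_iInf₂ fun q hq => (h q hq).2⟩

end MEC
end

section
/- Let p_1,...,p_m be pmfs on a finite set 𝒳. Then there exists a pmf q with q ⊑ p_i for every i ∈ [m] whose Shannon entropy satisfies H(q) ≤ H(⋀_{i∈[m]} p_i) + 2 − 2^{2−m}; consequently, the minimum Shannon entropy of couplings satisfies H*({p_1,...,p_m}) ≤ H(⋀_{i∈[m]} p_i) + 2 − 2^{2−m}, which is within 2 − 2^{2−m} ≤ 2 bits of the optimum. -/
open scoped ENNReal Classical
open Filter

namespace MEC

theorem exists_subset_sum_bracket {ι : Type*} (l : ι → ℝ) (A b : ℝ) (hb : 0 ≤ b) (U : Finset ι)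
    (hlA : ∀ j ∈ U, l j ≤ A) (hU : b ≤ ∑ j ∈ U, l j + A) :
    ∃ T ⊆ U, ∑ j ∈ T, l j ≤ b ∧ b ≤ ∑ j ∈ T, l j + A := by
  induction U using Finset.induction_on with
  | empty => exact ⟨∅, subset_rfl, by simpa using hb, hU⟩
  | insert j U hj ih =>
    by_cases h : b ≤ ∑ j ∈ U, l j + A
    · obtain ⟨T, hT, h1, h2⟩ := ih (fun i hi => hlA i (Finset.mem_insert_of_mem hi)) h
      exact ⟨T, hT.trans (Finset.subset_insert _ _), h1, h2⟩
    · refine ⟨insert j U, subset_rfl, ?_, hU⟩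
      rw [Finset.sum_insert hj]
      linarith [hlA j (Finset.mem_insert_self _ _)]

/-- If the partial sums of the monotone sequence `a` dominate those of `b`, then each `a j` can be
cut into a part `x j` put in bin `j` and a rest put in bin `g j`, so that the bins `i < n` get
total mass `b i`; the bin `n` collects the excess. -/
theorem exists_two_piece_split (a b : ℕ → ℝ) (n : ℕ) (hb : ∀ j < n, 0 ≤ b j)
    (ha : ∀ i j, i ≤ j → j < n → a i ≤ a j)
    (hab : ∀ k ≤ n, ∑ j ∈ Finset.range k, b j ≤ ∑ j ∈ Finset.range k, a j) :
    ∃ (x : ℕ → ℝ) (g : ℕ → ℕ), (∀ j < n, 0 ≤ x j ∧ x j ≤ a j ∧ g j ≤ n) ∧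
      (∀ i < n, b i = x i + ∑ j ∈ Finset.range n, if g j = i then a j - x j else 0) ∧
      (∑ j ∈ Finset.range n, if g j = n then a j - x j else 0) =
        ∑ j ∈ Finset.range n, (a j - b j) ∧
      ∀ k < n, a k - x k ≤ ∑ j ∈ Finset.range (k + 1), (a j - b j) := by
  induction n with
  | zero => exact ⟨a, fun _ => 0, by simp, by simp, by simp, by simp⟩
  | succ n ih =>
    obtain ⟨x, g, hx, hbin, hpool, htriv⟩ := ih (fun j hj => hb j (by omega))
      (fun i j hij hj => ha i j hij (by omega)) (fun k hk => hab k (by omega))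
    have htot := hab (n + 1) le_rfl
    rw [Finset.sum_range_succ, Finset.sum_range_succ] at htot
    have hpool' := hpool
    rw [← Finset.sum_filter] at hpool'
    obtain ⟨T, hTU, hT1, hT2⟩ := exists_subset_sum_bracket (fun j => a j - x j) (a n) (b n)
      (hb n (by omega)) ((Finset.range n).filter (fun j => g j = n))
      (fun j hj => by
        have hj' : j < n := by simpa using (Finset.mem_filter.1 hj).1
        have := ha j n hj'.le (by omega)
        have := (hx j hj').1
        linarith)
      (by rw [hpool', Finset.sum_sub_distrib]; linarith)
    have hT : ∀ j ∈ T, j < n ∧ g j = n := fun j hj => by simpa using hTU hj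
    have hsumT : (∑ j ∈ Finset.range n, if j ∈ T then a j - x j else 0) =
        ∑ j ∈ T, (a j - x j) := by
      rw [← Finset.sum_filter]
      congr 1
      ext j
      simp only [Finset.mem_filter, Finset.mem_range]
      exact ⟨fun h => h.2, fun h => ⟨(hT j h).1, h⟩⟩
    set x' : ℕ → ℝ := fun j => if j = n then b n - ∑ j ∈ T, (a j - x j) else x j with hx'
    set g' : ℕ → ℕ := fun j => if j = n then n + 1 else if j ∈ T then n else
      if g j = n then n + 1 else g j with hg'
    have hx'n : x' n = b n - ∑ j ∈ T, (a j - x j) := by simp [hx']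
    have hx'lt : ∀ j < n, x' j = x j := fun j hj => by simp [hx', hj.ne]
    have hg'n : g' n = n + 1 := by simp [hg']
    have hg'lt : ∀ j < n, g' j = if j ∈ T then n else if g j = n then n + 1 else g j :=
      fun j hj => by simp [hg', hj.ne]
    have hpool2 : (∑ j ∈ Finset.range (n + 1), if g' j = n + 1 then a j - x' j else 0) =
        ∑ j ∈ Finset.range (n + 1), (a j - b j) := by
      rw [Finset.sum_range_succ, Finset.sum_range_succ, if_pos hg'n, hx'n, ← hpool, ← hsumT]
      have : (∑ j ∈ Finset.range n, if g' j = n + 1 then a j - x' j else 0) =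
          (∑ j ∈ Finset.range n, if g j = n then a j - x j else 0) -
          ∑ j ∈ Finset.range n, if j ∈ T then a j - x j else 0 := by
        rw [← Finset.sum_sub_distrib]
        refine Finset.sum_congr rfl fun j hj => ?_
        have hj' : j < n := by simpa using hj
        rw [hx'lt j hj', hg'lt j hj']
        have := (hx j hj').2.2
        by_cases h : j ∈ T
        · simp [h, (hT j h).2]
        · by_cases h' : g j = n
          · simp [h, h']
          · have : g j ≠ n + 1 := by omega
            simp [h, h', this]
      rw [this]; ring
    have hx'b : ∀ j < n + 1, 0 ≤ x' j ∧ x' j ≤ a j ∧ g' j ≤ n + 1 := by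
      intro j hj
      rcases Nat.lt_succ_iff_lt_or_eq.1 hj with hj | rfl
      · rw [hx'lt j hj, hg'lt j hj]
        obtain ⟨h1, h2, h3⟩ := hx j hj
        refine ⟨h1, h2, ?_⟩
        split_ifs <;> omega
      · rw [hx'n, hg'n]
        exact ⟨by linarith, by linarith, le_rfl⟩
    refine ⟨x', g', hx'b, ?_, hpool2, ?_⟩
    · intro i hi
      rw [Finset.sum_range_succ, hg'n, if_neg (by omega), add_zero]
      rcases Nat.lt_succ_iff_lt_or_eq.1 hi with hi | rfl
      · rw [hx'lt i hi, hbin i hi]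
        congr 1
        refine Finset.sum_congr rfl fun j hj => ?_
        have hj' : j < n := by simpa using hj
        rw [hx'lt j hj', hg'lt j hj']
        by_cases h : j ∈ T
        · have := (hT j h).2
          have h1 : g j ≠ i := by omega
          simp [h, h1, hi.ne']
        · by_cases h' : g j = n
          · have h1 : g j ≠ i := by omega
            have h2 : n + 1 ≠ i := by omega
            simp [h, h', h2, hi.ne']
          · simp [h, h']
      · rw [hx'n, ← hsumT, sub_add_eq_add_sub, eq_sub_iff_add_eq]
        congr 1
        refine Finset.sum_congr rfl fun j hj => ?_
        have hj' : j < i := by simpa using hj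
        rw [hx'lt j hj', hg'lt j hj']
        by_cases h : j ∈ T
        · simp [h]
        · by_cases h' : g j = i <;> simp [h, h']
    · intro k hk
      rcases Nat.lt_succ_iff_lt_or_eq.1 hk with hk | rfl
      · rw [hx'lt k hk]; exact htriv k hk
      · rw [← hpool2]
        have := Finset.single_le_sum (f := fun j => if g' j = k + 1 then a j - x' j else 0)
          (s := Finset.range (k + 1)) (fun j hj => by
            have := (hx'b j (by simpa using hj)).2.1
            split_ifs <;> linarith) (Finset.self_mem_range_succ k)
        simpa [hg'n] using this

theorem negMulLog_add_le {s t : ℝ} (hs : 0 ≤ s) (ht : 0 ≤ t) :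
    Real.negMulLog s + Real.negMulLog t ≤ Real.negMulLog (s + t) + (s + t) * Real.log 2 := by
  have h := Real.concaveOn_negMulLog.2 (Set.mem_Ici.2 hs) (Set.mem_Ici.2 ht)
    (by norm_num : (0 : ℝ) ≤ 1 / 2) (by norm_num : (0 : ℝ) ≤ 1 / 2) (by norm_num)
  rw [show (1 / 2 : ℝ) • s + (1 / 2 : ℝ) • t = (1 / 2) * (s + t) by simp only [smul_eq_mul]; ring,
    Real.negMulLog_mul] at h
  have h2 : Real.negMulLog (1 / 2) = 1 / 2 * Real.log 2 := by
    rw [Real.negMulLog, one_div, Real.log_inv]; ring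
  rw [h2] at h
  simp only [smul_eq_mul] at h
  linarith

/-- Common refinement of `n` two-piece splits of the mass `s` into `n + 1` pieces, each but the last
taking at least half of what is left. -/
theorem exists_common_refinement {ι : Type*} (n : ℕ) (I : Finset ι) (hI : I.card = n) (s : ℝ)
    (hs : 0 ≤ s) (u : ι → ℝ) (hu : ∀ i ∈ I, 0 ≤ u i ∧ u i ≤ s) :
    ∃ (r : Fin (n + 1) → ℝ) (c : Fin (n + 1) → ι → Prop), (∀ j, 0 ≤ r j) ∧ ∑ j, r j = s ∧
      (∀ i ∈ I, (∑ j, if c j i then r j else 0) = u i) ∧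
      ∑ j, Real.negMulLog (r j) ≤
        Real.negMulLog s + s * ((2 - 2 * (1 / 2) ^ n) * Real.log 2) := by
  induction n generalizing I s u with
  | zero =>
    refine ⟨fun _ => s, fun _ _ => True, fun _ => hs, by simp, ?_, by simp⟩
    simp [Finset.card_eq_zero.1 hI]
  | succ n ih =>
    have hne : I.Nonempty := Finset.card_pos.1 (by omega)
    obtain ⟨i₀, hi₀, hmin⟩ := I.exists_min_image (fun i => max (u i) (s - u i)) hne
    set b := max (u i₀) (s - u i₀) with hb
    have hb_half : s / 2 ≤ b := by
      rcases le_total (u i₀) (s / 2) with h | h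
      · exact le_max_of_le_right (by linarith)
      · exact le_max_of_le_left h
    have hbs : b ≤ s := max_le (hu i₀ hi₀).2 (by linarith [(hu i₀ hi₀).1])
    have hu' : ∀ i ∈ I, ¬ b ≤ u i → b ≤ s - u i := fun i hi h =>
      (le_max_iff.1 (hmin i hi)).resolve_left h
    obtain ⟨r, c, hr, hrs, hc, hent⟩ := ih (I.erase i₀) (by rw [Finset.card_erase_of_mem hi₀, hI]; rfl)
      (s - b) (by linarith) (fun i => if b ≤ u i then u i - b else u i) (by
        intro i hi
        have hiI := Finset.mem_of_mem_erase hi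
        have := hu i hiI
        split_ifs with h
        · exact ⟨by linarith, by linarith⟩
        · exact ⟨by linarith, by linarith [hu' i hiI h]⟩)
    refine ⟨Fin.cons b r, Fin.cons (fun i => b ≤ u i)
      (fun j i => if i = i₀ then ¬ b ≤ u i₀ else c j i), ?_, ?_, ?_, ?_⟩
    · intro j
      refine Fin.cases ?_ (fun j => ?_) j
      · simp only [Fin.cons_zero]; linarith
      · simpa using hr j
    · rw [Fin.sum_univ_succ]; simp [hrs]
    · intro i hi
      rw [Fin.sum_univ_succ]
      simp only [Fin.cons_zero, Fin.cons_succ]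
      by_cases h : i = i₀
      · subst h
        simp only [if_true]
        by_cases h : b ≤ u i
        · simp only [h, if_true, not_true_eq_false, if_false, Finset.sum_const_zero, add_zero]
          exact le_antisymm h (le_max_left _ _)
        · simp only [h, if_false, not_false_eq_true, if_true, hrs, zero_add]
          have : b = s - u i := (max_choice _ _).resolve_left (fun h' => h (hb.trans h').le)
          linarith
      · simp only [if_neg h]
        rw [hc i (Finset.mem_erase.2 ⟨h, hi⟩)]
        split_ifs <;> ring
    · rw [Fin.sum_univ_succ]
      simp only [Fin.cons_zero, Fin.cons_succ]
      have h1 := negMulLog_add_le (by linarith : 0 ≤ b) (by linarith : 0 ≤ s - b)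
      rw [add_sub_cancel] at h1
      have h2 : (s - b) * ((2 - 2 * (1 / 2) ^ n) * Real.log 2) ≤
          s / 2 * ((2 - 2 * (1 / 2) ^ n) * Real.log 2) := by
        refine mul_le_mul_of_nonneg_right (by linarith) (mul_nonneg ?_ (Real.log_nonneg one_le_two))
        have : (1 / 2 : ℝ) ^ n ≤ 1 := pow_le_one₀ (by norm_num) (by norm_num)
        linarith
      have h3 : s * ((2 - 2 * (1 / 2) ^ (n + 1)) * Real.log 2) =
          s * Real.log 2 + s / 2 * ((2 - 2 * (1 / 2 : ℝ) ^ n) * Real.log 2) := by ring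
      linarith

theorem exists_common_refinement_of_trivial (n : ℕ) (s : ℝ)
    (hs : 0 ≤ s) (u : Fin (n + 1) → ℝ) (hu : ∀ i, 0 ≤ u i ∧ u i ≤ s) (i₀ : Fin (n + 1))
    (hi₀ : u i₀ = s) :
    ∃ (r : Fin (n + 1) → ℝ) (c : Fin (n + 1) → Fin (n + 1) → Prop), (∀ j, 0 ≤ r j) ∧
      ∑ j, r j = s ∧ (∀ i, (∑ j, if c j i then r j else 0) = u i) ∧
      ∑ j, Real.negMulLog (r j) ≤
        Real.negMulLog s + s * ((2 - 2 * (1 / 2) ^ n) * Real.log 2) := by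
  obtain ⟨r, c, hr, hrs, hc, hent⟩ := exists_common_refinement n (Finset.univ.erase i₀)
    (by simp) s hs u (fun i _ => hu i)
  refine ⟨r, fun j i => i = i₀ ∨ c j i, hr, hrs, fun i => ?_, hent⟩
  by_cases h : i = i₀
  · simp [h, hrs, hi₀]
  · simpa [h] using hc i (by simp [h])

theorem exists_two_piece_split_of_sum_eq (a b : ℕ → ℝ) (n : ℕ) (hb : ∀ j < n, 0 ≤ b j)
    (ha : ∀ i j, i ≤ j → j < n → a i ≤ a j)
    (hab : ∀ k ≤ n, ∑ j ∈ Finset.range k, b j ≤ ∑ j ∈ Finset.range k, a j)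
    (htot : ∑ j ∈ Finset.range n, b j = ∑ j ∈ Finset.range n, a j) :
    ∃ (x : ℕ → ℝ) (g : ℕ → ℕ), (∀ j < n, 0 ≤ x j ∧ x j ≤ a j ∧ g j < n) ∧
      (∀ i < n, b i = x i + ∑ j ∈ Finset.range n, if g j = i then a j - x j else 0) ∧
      ∀ k < n, a k - x k ≤ ∑ j ∈ Finset.range (k + 1), (a j - b j) := by
  obtain ⟨x, g, hx, hbin, hpool, htriv⟩ := exists_two_piece_split a b n hb ha hab
  rw [Finset.sum_sub_distrib, htot, sub_self, Finset.sum_eq_zero_iff_of_nonneg] at hpool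
  · refine ⟨x, fun j => if g j < n then g j else j, fun j hj => ⟨(hx j hj).1, (hx j hj).2.1, ?_⟩,
      fun i hi => ?_, htriv⟩
    · dsimp only
      split_ifs <;> assumption
    · rw [hbin i hi]
      congr 1
      refine Finset.sum_congr rfl fun j hj => ?_
      have hj' := Finset.mem_range.1 hj
      by_cases h : g j < n
      · simp [h]
      · have h' : g j = n := by have := (hx j hj').2.2; omega
        have := hpool j hj
        rw [if_pos h'] at this
        simp [this]
  · intro j hj
    have := (hx j (Finset.mem_range.1 hj)).2.1
    split_ifs <;> linarith

/-- The increments of the pointwise maximum of the partial sums of finitely many sequences. -/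
noncomputable def maxIncrement {n : ℕ} (b : Fin (n + 1) → ℕ → ℝ) (k : ℕ) : ℝ :=
  (Finset.univ.sup' Finset.univ_nonempty fun i => ∑ j ∈ Finset.range (k + 1), b i j) -
    Finset.univ.sup' Finset.univ_nonempty fun i => ∑ j ∈ Finset.range k, b i j

section MaxIncrement

variable {n : ℕ} (b : Fin (n + 1) → ℕ → ℝ)

theorem sum_maxIncrement (k : ℕ) : ∑ j ∈ Finset.range k, maxIncrement b j =
    Finset.univ.sup' Finset.univ_nonempty fun i => ∑ j ∈ Finset.range k, b i j := by
  simp only [maxIncrement]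
  rw [Finset.sum_range_sub (fun k => Finset.univ.sup' Finset.univ_nonempty
    fun i => ∑ j ∈ Finset.range k, b i j)]
  simp

theorem sum_le_sum_maxIncrement (i : Fin (n + 1)) (k : ℕ) :
    ∑ j ∈ Finset.range k, b i j ≤ ∑ j ∈ Finset.range k, maxIncrement b j := by
  rw [sum_maxIncrement]
  exact Finset.le_sup' (fun i => ∑ j ∈ Finset.range k, b i j) (Finset.mem_univ i)

theorem exists_sum_eq_sum_maxIncrement (k : ℕ) : ∃ i,
    ∑ j ∈ Finset.range k, maxIncrement b j = ∑ j ∈ Finset.range k, b i j := by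
  rw [sum_maxIncrement]
  obtain ⟨i, -, hi⟩ := Finset.exists_mem_eq_sup' Finset.univ_nonempty
    (fun i => ∑ j ∈ Finset.range k, b i j)
  exact ⟨i, hi⟩

theorem sum_maxIncrement_eq_one {N : ℕ} (hsum : ∀ i, ∑ j ∈ Finset.range N, b i j = 1) :
    ∑ j ∈ Finset.range N, maxIncrement b j = 1 := by
  obtain ⟨i, hi⟩ := exists_sum_eq_sum_maxIncrement b N
  rw [hi, hsum]

theorem maxIncrement_nonneg (hb : ∀ i j, 0 ≤ b i j) (k : ℕ) : 0 ≤ maxIncrement b k := by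
  obtain ⟨i, hi⟩ := exists_sum_eq_sum_maxIncrement b k
  have h := sum_le_sum_maxIncrement b i (k + 1)
  rw [Finset.sum_range_succ, Finset.sum_range_succ, hi] at h
  linarith [hb i k]

theorem maxIncrement_mono {N : ℕ} (hb : ∀ i j k, j ≤ k → k < N → b i j ≤ b i k) (j k : ℕ)
    (hjk : j ≤ k) (hk : k < N) : maxIncrement b j ≤ maxIncrement b k := by
  induction k, hjk using Nat.le_induction with
  | base => rfl
  | succ k hjk ih =>
    refine (ih (by omega)).trans ?_
    obtain ⟨i, hi⟩ := exists_sum_eq_sum_maxIncrement b (k + 1)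
    have h1 := sum_le_sum_maxIncrement b i k
    have h2 := sum_le_sum_maxIncrement b i (k + 2)
    rw [Finset.sum_range_succ, Finset.sum_range_succ _ (k + 1), hi] at h2
    rw [Finset.sum_range_succ, Finset.sum_range_succ] at hi
    linarith [hb i k (k + 1) (by omega) hk]

end MaxIncrement

/-- Real-valued form of the coupling: the masses `maxIncrement b k` are cut into pieces `r k j`
that can be regrouped, through `d i`, into each of the sequences `b i`. -/
theorem exists_coupling_of_sorted (n N : ℕ) (b : Fin (n + 1) → ℕ → ℝ) (hb : ∀ i j, 0 ≤ b i j)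
    (hmono : ∀ i j k, j ≤ k → k < N → b i j ≤ b i k)
    (hsum : ∀ i, ∑ j ∈ Finset.range N, b i j = 1) :
    ∃ (r : Fin N → Fin (n + 1) → ℝ) (d : Fin (n + 1) → Fin N → Fin (n + 1) → Fin N),
      (∀ k j, 0 ≤ r k j) ∧ (∑ k, ∑ j, r k j = 1) ∧
      (∀ i (y : Fin N), b i y = ∑ k, ∑ j, if d i k j = y then r k j else 0) ∧
      ∑ k, ∑ j, Real.negMulLog (r k j) ≤ ∑ k ∈ Finset.range N, Real.negMulLog (maxIncrement b k) +
        (2 - 2 * (1 / 2) ^ n) * Real.log 2 := by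
  set a := maxIncrement b with ha
  have hatot : ∑ j ∈ Finset.range N, a j = 1 := sum_maxIncrement_eq_one b hsum
  choose x g hx hbin htriv using fun i => exists_two_piece_split_of_sum_eq a (b i) N
    (fun j _ => hb i j) (maxIncrement_mono b hmono) (fun k _ => sum_le_sum_maxIncrement b i k)
    (by rw [hsum, hatot])
  have hpiece : ∀ k : Fin N, ∃ (r : Fin (n + 1) → ℝ) (c : Fin (n + 1) → Fin (n + 1) → Prop),
      (∀ j, 0 ≤ r j) ∧ ∑ j, r j = a k ∧ (∀ i, (∑ j, if c j i then r j else 0) = x i k) ∧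
      ∑ j, Real.negMulLog (r j) ≤
        Real.negMulLog (a k) + a k * ((2 - 2 * (1 / 2) ^ n) * Real.log 2) := by
    intro k
    obtain ⟨i, hi⟩ := exists_sum_eq_sum_maxIncrement b (k + 1)
    refine exists_common_refinement_of_trivial n (a k) (maxIncrement_nonneg b hb k)
      (fun i => x i k) (fun i => ⟨(hx i k k.2).1, (hx i k k.2).2.1⟩) i ?_
    have := htriv i k k.2
    rw [Finset.sum_sub_distrib, ha, hi, sub_self] at this
    exact le_antisymm (hx i k k.2).2.1 (by linarith)
  choose r c hr hrs hc hent using hpiece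
  refine ⟨r, fun i k j => if c k j i then k else ⟨g i k, (hx i k k.2).2.2⟩, hr, ?_, ?_, ?_⟩
  · simp only [hrs]
    rw [← hatot, Finset.sum_range]
  · intro i y
    have hk : ∀ (k : Fin N) (h : g i k < N), (∑ j, if (if c k j i then k else ⟨g i k, h⟩) = y
        then r k j else 0) =
        (if k = y then x i k else 0) + if g i k = y then a k - x i k else 0 := by
      intro k h
      have h1 : (∑ j, if c k j i then 0 else r k j) = a k - x i k := by
        rw [← hrs k, ← hc k i, ← Finset.sum_sub_distrib]
        refine Finset.sum_congr rfl fun j _ => ?_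
        split_ifs <;> ring
      rw [← h1, ← hc k i, Finset.ite_sum_zero, Finset.ite_sum_zero, ← Finset.sum_add_distrib]
      refine Finset.sum_congr rfl fun j _ => ?_
      by_cases h : c k j i <;> simp [h, Fin.ext_iff]
    simp only [hk, Finset.sum_add_distrib, Finset.sum_ite_eq', Finset.mem_univ, if_true]
    rw [hbin i y y.2, Finset.sum_range]
  · refine (Finset.sum_le_sum fun k _ => hent k).trans ?_
    rw [Finset.sum_add_distrib, ← Finset.sum_mul,
      ← Finset.sum_range (fun k => Real.negMulLog (a k)), ← Finset.sum_range a, hatot, one_mul]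

theorem agg_of_forall_eq {α β : Type*} {q : α → ℝ≥0∞} {p : β → ℝ≥0∞} (g : α → β)
    (h : ∀ y, p y = ∑' x, if g x = y then q x else 0) : Agg q p := by
  refine ⟨g, fun x hx hp => hx ?_, h⟩
  rw [h, ENNReal.tsum_eq_zero] at hp
  simpa using hp x

theorem extend_comp_zero {α β γ δ : Type*} [Zero γ] [Zero δ] {f : α → β}
    (hf : Function.Injective f) (w : α → γ) (F : β → γ → δ) (hF : ∀ n, F n 0 = 0) :
    (fun n => F n (Function.extend f w 0 n)) =
      Function.extend f (fun x => F (f x) (w x)) 0 := by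
  ext n
  by_cases h : ∃ x, f x = n
  · obtain ⟨x, rfl⟩ := h
    simp [hf.extend_apply]
  · simp [Function.extend_apply' _ _ _ h, hF]

/-- A function on a countable type can be transported to `ℕ`. -/
theorem exists_nat_model {α : Type*} [Countable α] (w : α → ℝ≥0∞) :
    ∃ q : ℕ → ℝ≥0∞, ∑' n, q n = ∑' x, w x ∧ shannon q = shannon w ∧
      ∀ {β : Type*} [Nonempty β] (p : β → ℝ≥0∞), Agg w p → Agg q p := by
  obtain ⟨f, hf⟩ := exists_injective_nat α
  refine ⟨Function.extend f w 0, tsum_extend_zero hf w, ?_, ?_⟩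
  · simp only [shannon]
    rw [extend_comp_zero hf w (fun _ t => t * log2 t⁻¹) (by simp), tsum_extend_zero hf]
  · rintro β _ p ⟨g, -, hg⟩
    refine agg_of_forall_eq (Function.extend f g fun _ => Classical.arbitrary β) fun y => ?_
    rw [hg, extend_comp_zero hf w
      (fun n t => if Function.extend f g (fun _ => Classical.arbitrary β) n = y then t else 0)
      (by simp), tsum_extend_zero hf]
    simp [hf.extend_apply]

theorem ofReal_mul_log2_inv {t : ℝ} (h0 : 0 ≤ t) (h1 : t ≤ 1) :
    ENNReal.ofReal t * log2 (ENNReal.ofReal t)⁻¹ =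
      ENNReal.ofReal (Real.negMulLog t / Real.log 2) := by
  rcases h0.eq_or_lt with rfl | h0
  · simp
  · rw [log2, if_neg (by simpa using h0), ENNReal.toReal_inv, ENNReal.toReal_ofReal h0.le,
      ← ENNReal.ofReal_mul h0.le, Real.logb, Real.log_inv, Real.negMulLog]
    congr 1
    ring

theorem sum_range_card_le_sum (f : ℕ → ℝ) (N : ℕ) (hf : ∀ j k, j ≤ k → k < N → f j ≤ f k)
    (s : Finset ℕ) (hs : s ⊆ Finset.range N) : ∑ j ∈ Finset.range s.card, f j ≤ ∑ j ∈ s, f j := by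
  induction s using Finset.induction_on_max with
  | empty => simp
  | insert a s ha ih =>
    have hnot : a ∉ s := fun h => lt_irrefl _ (ha a h)
    have hcard : s.card ≤ a := by
      simpa using Finset.card_le_card (fun x hx => Finset.mem_range.2 (ha x hx) :
        s ⊆ Finset.range a)
    rw [Finset.card_insert_of_notMem hnot, Finset.sum_range_succ, Finset.sum_insert hnot]
    have := ih ((Finset.subset_insert _ _).trans hs)
    have := hf _ _ hcard (Finset.mem_range.1 (hs (Finset.mem_insert_self _ _)))
    linarith

theorem exists_sorting {X : Type*} [Fintype X] (p : X → ℝ≥0∞) (hp : IsPMF p) :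
    ∃ (e : X ≃ Fin (Fintype.card X)) (b : ℕ → ℝ), (∀ x, p x = ENNReal.ofReal (b (e x))) ∧
      (∀ j, 0 ≤ b j) ∧ (∀ j k, j ≤ k → k < Fintype.card X → b j ≤ b k) ∧
      ∑ j ∈ Finset.range (Fintype.card X), b j = 1 := by
  have hfin : ∀ x, p x ≠ ∞ := ENNReal.ne_top_of_tsum_ne_top (by rw [show ∑' x, p x = 1 from hp]; simp)
  set f := p ∘ (Fintype.equivFin X).symm
  set e := (Fintype.equivFin X).trans (Tuple.sort f).symm
  set b : ℕ → ℝ := fun j => if h : j < Fintype.card X then (p (e.symm ⟨j, h⟩)).toReal else 0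
  have hbe : ∀ x, b (e x) = (p x).toReal := fun x => by simp [b]
  refine ⟨e, b, fun x => ?_, fun j => ?_, fun j k hjk hk => ?_, ?_⟩
  · rw [hbe, ENNReal.ofReal_toReal (hfin x)]
  · dsimp only [b]
    split_ifs <;> simp
  · simp only [b, hk, hjk.trans_lt hk, dif_pos]
    exact ENNReal.toReal_mono (hfin _)
      (Tuple.monotone_sort f (show (⟨j, hjk.trans_lt hk⟩ : Fin _) ≤ ⟨k, hk⟩ from hjk))
  · rw [Finset.sum_range, ← Equiv.sum_comp e]
    simp only [hbe]
    rw [← ENNReal.toReal_sum fun x _ => hfin x, show ∑ x, p x = 1 from (tsum_fintype p).symm.trans hp,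
      ENNReal.toReal_one]

theorem topk_eq_of_sorting {X : Type*} [Fintype X] (p : X → ℝ≥0∞) {N : ℕ} (e : X ≃ Fin N)
    (b : ℕ → ℝ) (hpb : ∀ x, p x = ENNReal.ofReal (b (e x))) (hb : ∀ j, 0 ≤ b j)
    (hmono : ∀ j k, j ≤ k → k < N → b j ≤ b k) (hsum : ∑ j ∈ Finset.range N, b j = 1) (k : ℕ) :
    topk p k = ENNReal.ofReal (1 - ∑ j ∈ Finset.range (N - k), b j) := by
  have hinj : Function.Injective fun x => (e x : ℕ) := Fin.val_injective.comp e.injective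
  have hA : ∀ A : Finset X, ∑ x ∈ A, p x =
      ENNReal.ofReal (∑ j ∈ A.image fun x => (e x : ℕ), b j) := by
    intro A
    rw [Finset.sum_image hinj.injOn, ENNReal.ofReal_sum_of_nonneg fun x _ => hb _]
    exact Finset.sum_congr rfl fun x _ => hpb x
  refine le_antisymm (iSup₂_le fun A hAk => ?_) ?_
  · rw [hA]
    refine ENNReal.ofReal_le_ofReal ?_
    set s := A.image fun x => (e x : ℕ) with hs
    have hsN : s ⊆ Finset.range N := fun j hj => by
      obtain ⟨x, -, rfl⟩ := Finset.mem_image.1 hj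
      simp
    have h1 := sum_range_card_le_sum b N hmono (Finset.range N \ s) Finset.sdiff_subset
    have h2 := Finset.sum_sdiff hsN (f := b)
    rw [Finset.card_sdiff_of_subset hsN, hs, Finset.card_image_of_injective _ hinj, ← hs,
      Finset.card_range] at h1
    have h3 : ∑ j ∈ Finset.range (N - k), b j ≤ ∑ j ∈ Finset.range (N - A.card), b j :=
      Finset.sum_le_sum_of_subset_of_nonneg (Finset.range_mono (by omega)) fun j _ _ => hb j
    linarith
  · set A : Finset X := Finset.univ.filter fun x => N - k ≤ e x with hAdef
    have himg : (A.image fun x => (e x : ℕ)) = Finset.Ico (N - k) N := by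
      ext j
      simp only [hAdef, Finset.mem_image, Finset.mem_filter, Finset.mem_univ, true_and,
        Finset.mem_Ico]
      constructor
      · rintro ⟨x, hx, rfl⟩
        exact ⟨hx, (e x).2⟩
      · rintro ⟨h1, h2⟩
        exact ⟨e.symm ⟨j, h2⟩, by simpa using h1, by simp⟩
    have hcard : A.card ≤ k := by
      rw [← Finset.card_image_of_injective A hinj, himg, Nat.card_Ico]
      omega
    refine le_trans ?_ (le_iSup₂ (f := fun (A : Finset X) (_ : A.card ≤ k) => ∑ x ∈ A, p x) A hcard)
    rw [hA, himg, Finset.sum_Ico_eq_sub _ (Nat.sub_le _ _), hsum]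

theorem infTopk_eq_of_sorting {X : Type*} [Fintype X] {n N : ℕ} (p : Fin (n + 1) → X → ℝ≥0∞)
    (e : Fin (n + 1) → X ≃ Fin N) (b : Fin (n + 1) → ℕ → ℝ)
    (hpb : ∀ i x, p i x = ENNReal.ofReal (b i (e i x))) (hb : ∀ i j, 0 ≤ b i j)
    (hmono : ∀ i j k, j ≤ k → k < N → b i j ≤ b i k)
    (hsum : ∀ i, ∑ j ∈ Finset.range N, b i j = 1) (k : ℕ) :
    infTopk (Set.range p) k =
      ENNReal.ofReal (1 - ∑ j ∈ Finset.range (N - k), maxIncrement b j) := by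
  rw [infTopk, iInf_range]
  simp only [fun i => topk_eq_of_sorting (p i) (e i) (b i) (hpb i) (hb i) (hmono i) (hsum i) k]
  refine le_antisymm ?_ (le_iInf fun i => ENNReal.ofReal_le_ofReal ?_)
  · obtain ⟨i, hi⟩ := exists_sum_eq_sum_maxIncrement b (N - k)
    rw [hi]
    exact iInf_le _ i
  · linarith [sum_le_sum_maxIncrement b i (N - k)]

theorem glb_eq_of_sorting {X : Type*} [Fintype X] {n N : ℕ} (p : Fin (n + 1) → X → ℝ≥0∞)
    (e : Fin (n + 1) → X ≃ Fin N) (b : Fin (n + 1) → ℕ → ℝ)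
    (hpb : ∀ i x, p i x = ENNReal.ofReal (b i (e i x))) (hb : ∀ i j, 0 ≤ b i j)
    (hmono : ∀ i j k, j ≤ k → k < N → b i j ≤ b i k)
    (hsum : ∀ i, ∑ j ∈ Finset.range N, b i j = 1) (k : ℕ+) :
    glb (Set.range p) k =
      if (k : ℕ) ≤ N then ENNReal.ofReal (maxIncrement b (N - k)) else 0 := by
  have ha := maxIncrement_nonneg b hb
  have htot := sum_maxIncrement_eq_one b hsum
  have hk := k.pos
  rw [glb, infTopk_eq_of_sorting p e b hpb hb hmono hsum,
    infTopk_eq_of_sorting p e b hpb hb hmono hsum]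
  split_ifs with h
  · have h1 : N - ((k : ℕ) - 1) = N - k + 1 := by omega
    have h2 : ∑ j ∈ Finset.range (N - k + 1), maxIncrement b j ≤ 1 := by
      rw [← htot]
      exact Finset.sum_le_sum_of_subset_of_nonneg (Finset.range_mono (by omega)) fun j _ _ => ha j
    rw [h1, ← ENNReal.ofReal_sub _ (by linarith), Finset.sum_range_succ]
    congr 1
    ring
  · have h1 : N - (k : ℕ) = 0 := by omega
    have h2 : N - ((k : ℕ) - 1) = 0 := by omega
    rw [h1, h2, tsub_self]

theorem shannon_glb_eq_of_sorting {X : Type*} [Fintype X] {n N : ℕ} (p : Fin (n + 1) → X → ℝ≥0∞)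
    (e : Fin (n + 1) → X ≃ Fin N) (b : Fin (n + 1) → ℕ → ℝ)
    (hpb : ∀ i x, p i x = ENNReal.ofReal (b i (e i x))) (hb : ∀ i j, 0 ≤ b i j)
    (hmono : ∀ i j k, j ≤ k → k < N → b i j ≤ b i k)
    (hsum : ∀ i, ∑ j ∈ Finset.range N, b i j = 1) :
    shannon (glb (Set.range p)) =
      ENNReal.ofReal ((∑ k ∈ Finset.range N, Real.negMulLog (maxIncrement b k)) / Real.log 2) := by
  have ha := maxIncrement_nonneg b hb
  have htot := sum_maxIncrement_eq_one b hsum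
  have ha1 : ∀ k < N, maxIncrement b k ≤ 1 := fun k hk => by
    rw [← htot]
    exact Finset.single_le_sum (fun j _ => ha j) (Finset.mem_range.2 hk)
  rw [shannon]
  simp only [glb_eq_of_sorting p e b hpb hb hmono hsum]
  rw [tsum_pnat_eq_tsum_succ (f := fun k : ℕ =>
    (if k ≤ N then ENNReal.ofReal (maxIncrement b (N - k)) else 0) *
      log2 (if k ≤ N then ENNReal.ofReal (maxIncrement b (N - k)) else 0)⁻¹),
    tsum_eq_sum (s := Finset.range N) (fun k hk => by
      rw [if_neg (by simpa using hk)]; simp),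
    Finset.sum_div, ENNReal.ofReal_sum_of_nonneg, ← Finset.sum_range_reflect]
  · refine Finset.sum_congr rfl fun k hk => ?_
    have hk' := Finset.mem_range.1 hk
    rw [if_pos (by omega), show N - (N - 1 - k + 1) = k by omega, ofReal_mul_log2_inv (ha _) (ha1 _ hk')]
  · intro k hk
    exact div_nonneg (Real.negMulLog_nonneg (ha k) (ha1 k (Finset.mem_range.1 hk)))
      (Real.log_nonneg one_le_two)

theorem two_sub_rpow_eq (n : ℕ) : 2 - (2 : ℝ≥0∞) ^ ((2 : ℝ) - ((n + 1 : ℕ) : ℝ)) =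
    ENNReal.ofReal (2 - 2 * (1 / 2) ^ n) := by
  have h : (2 : ℝ) ^ ((2 : ℝ) - ((n + 1 : ℕ) : ℝ)) = 2 * (1 / 2) ^ n := by
    rw [show (2 : ℝ) - ((n + 1 : ℕ) : ℝ) = 1 - (n : ℝ) by push_cast; ring,
      Real.rpow_sub two_pos, Real.rpow_one, Real.rpow_natCast, one_div, inv_pow, div_eq_mul_inv]
  rw [← h, ENNReal.ofReal_sub _ (by positivity), ← ENNReal.ofReal_rpow_of_pos two_pos]
  simp

theorem exists_coupling_shannon_le {n : ℕ} {X : Type*} [Fintype X]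
    (p : Fin (n + 1) → X → ℝ≥0∞) (hp : ∀ i, IsPMF (p i)) :
    ∃ q : ℕ → ℝ≥0∞, IsPMF q ∧ (∀ i, Agg q (p i)) ∧
      shannon q ≤ shannon (glb (Set.range p)) + ENNReal.ofReal (2 - 2 * (1 / 2) ^ n) := by
  choose e b hpb hb hmono hsum using fun i => exists_sorting (p i) (hp i)
  obtain ⟨r, d, hr, hr1, hd, hent⟩ := exists_coupling_of_sorted n _ b hb hmono hsum
  have hX : Nonempty X := by
    by_contra h
    have := not_nonempty_iff.1 h
    have h0 := hsum 0
    simp at h0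
  obtain ⟨q, hq, hshannon, hagg⟩ := exists_nat_model
    fun z : Fin (Fintype.card X) × Fin (n + 1) => ENNReal.ofReal (r z.1 z.2)
  have hsum1 : ∑ z : Fin (Fintype.card X) × Fin (n + 1), r z.1 z.2 = 1 := by
    rw [Fintype.sum_prod_type, hr1]
  have hle1 : ∀ z : Fin (Fintype.card X) × Fin (n + 1), r z.1 z.2 ≤ 1 := fun z => by
    rw [← hsum1]
    exact Finset.single_le_sum (f := fun z : Fin (Fintype.card X) × Fin (n + 1) => r z.1 z.2)
      (fun z _ => hr z.1 z.2) (Finset.mem_univ z)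
  have hlog : 0 < Real.log 2 := Real.log_pos one_lt_two
  refine ⟨q, ?_, fun i => hagg _ (agg_of_forall_eq (fun z => (e i).symm (d i z.1 z.2)) fun y => ?_),
    ?_⟩
  · rw [IsPMF, hq, tsum_fintype, ← ENNReal.ofReal_sum_of_nonneg fun z _ => hr z.1 z.2, hsum1,
      ENNReal.ofReal_one]
  · have hite : ∀ z : Fin (Fintype.card X) × Fin (n + 1),
        (if (e i).symm (d i z.1 z.2) = y then ENNReal.ofReal (r z.1 z.2) else 0) =
          ENNReal.ofReal (if d i z.1 z.2 = e i y then r z.1 z.2 else 0) := fun z => by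
      simp only [Equiv.symm_apply_eq]
      split_ifs <;> simp
    rw [hpb, hd, tsum_fintype]
    simp only [hite]
    rw [← ENNReal.ofReal_sum_of_nonneg fun z _ => by split_ifs <;> simp [hr],
      Fintype.sum_prod_type]
  · rw [hshannon, shannon, shannon_glb_eq_of_sorting p e b hpb hb hmono hsum, tsum_fintype]
    simp only [fun z : Fin (Fintype.card X) × Fin (n + 1) =>
      ofReal_mul_log2_inv (hr z.1 z.2) (hle1 z)]
    rw [← ENNReal.ofReal_sum_of_nonneg fun z _ =>
      div_nonneg (Real.negMulLog_nonneg (hr z.1 z.2) (hle1 z)) hlog.le, ← Finset.sum_div,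
      Fintype.sum_prod_type]
    refine (ENNReal.ofReal_le_ofReal ?_).trans ENNReal.ofReal_add_le
    rw [div_add' _ _ _ hlog.ne']
    exact div_le_div_of_nonneg_right hent hlog.le

/-- main result, Eq. (1): for pmfs `p₁,…,pₘ` on a finite set `𝒳`, there
is a coupling, i.e. a pmf `q` with `q ⊑ pᵢ` for all `i`, whose Shannon entropy satisfies
`H(q) ≤ H(⋀ᵢ pᵢ) + 2 − 2^{2−m}`; consequently
`H*({p₁,…,pₘ}) ≤ H(⋀ᵢ pᵢ) + 2 − 2^{2−m}`, which is within `2 − 2^{2−m} ≤ 2` bits of the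
optimum. -/
theorem approx_min_entropy_coupling (m : ℕ) (hm : 1 ≤ m) {X : Type*} [Fintype X]
    (p : Fin m → X → ℝ≥0∞) (hp : ∀ i, IsPMF (p i)) :
    (∃ q : ℕ → ℝ≥0∞, IsPMF q ∧ (∀ i, Agg q (p i)) ∧
      shannon q ≤ shannon (glb (Set.range p)) + (2 - (2 : ℝ≥0∞) ^ ((2 : ℝ) - (m : ℝ)))) ∧
    minRenyi (Set.range p) 1 ≤
      shannon (glb (Set.range p)) + (2 - (2 : ℝ≥0∞) ^ ((2 : ℝ) - (m : ℝ))) ∧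
    (2 - (2 : ℝ≥0∞) ^ ((2 : ℝ) - (m : ℝ))) ≤ 2 := by
  obtain ⟨n, rfl⟩ : ∃ n, m = n + 1 := ⟨m - 1, by omega⟩
  rw [two_sub_rpow_eq]
  obtain ⟨q, hq, hagg, hent⟩ := exists_coupling_shannon_le p hp
  refine ⟨⟨q, hq, hagg, hent⟩, ?_, by rw [← two_sub_rpow_eq]; exact tsub_le_self⟩
  refine (iInf₂_le q ⟨hq, ?_⟩).trans (by rwa [renyi, if_pos rfl])
  rintro _ ⟨i, rfl⟩
  exact hagg i

end MEC
end
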